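/- arXiv:2312.07335 — 3 statements merged into one kernel-verified Lean document; each statement's English description precedes it below -/
import Mathlib

section
/- Let p : ℝ^{d_x} → (0,∞) and r : ℝ^{d_u} → (0,∞) be differentiable, and let q be a differentiable, everywhere positive probability density on ℝ^{d_x} × ℝ^{d_u} whose marginal q_X(x) := ∫ q(x,u) du is positive, differentiable, and satisfies ∇_x q_X(x) = ∫ ∇_x q(x,u) du for all x (differentiation under the integral is valid). Assume all integrals below are finite. Then ∫∫ ‖∇_{(x,u)} log( q(x,u) / (p(x) r(u)) )‖² q(x,u) dx du ≥ ∫ ‖∇_x log( q_X(x)/p(x) )‖² q_X(x) dx + ∫∫ ‖∇_u log( q(x,u) / (q_X(x) r(u)) )‖² q(x,u) dx du. -/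
open MeasureTheory

section GradientLog

variable {F : Type*} [NormedAddCommGroup F] [InnerProductSpace ℝ F] [CompleteSpace F]

theorem gradient_log_div {f g : F → ℝ} {x : F} (hf : DifferentiableAt ℝ f x)
    (hg : DifferentiableAt ℝ g x) (hfpos : ∀ y, 0 < f y) (hgpos : ∀ y, 0 < g y) :
    gradient (fun y => Real.log (f y / g y)) x
      = (f x)⁻¹ • gradient f x - (g x)⁻¹ • gradient g x := by
  have hlog : (fun y => Real.log (f y / g y)) = fun y => Real.log (f y) - Real.log (g y) :=
    funext fun y => Real.log_div (hfpos y).ne' (hgpos y).ne'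
  have h := ((hf.hasFDerivAt.log (hfpos x).ne').fun_sub (hg.hasFDerivAt.log (hgpos x).ne')).fderiv
  simp only [gradient, hlog, h, map_sub, map_smulₛₗ, conj_trivial]

theorem gradient_log_div_mul_const {f g : F → ℝ} {c : ℝ} (hc : 0 < c) (hfpos : ∀ y, 0 < f y)
    (hgpos : ∀ y, 0 < g y) (x : F) :
    gradient (fun y => Real.log (f y / (g y * c))) x
      = gradient (fun y => Real.log (f y / g y)) x := by
  have hlog : (fun y => Real.log (f y / (g y * c))) = fun y => Real.log (f y / g y) - Real.log c :=
    funext fun y => by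
      rw [← div_div, Real.log_div (div_pos (hfpos y) (hgpos y)).ne' hc.ne']
  simp only [gradient, hlog, fderiv_sub_const]

theorem gradient_log_div_const_mul {f g : F → ℝ} {c : ℝ} (hc : 0 < c) (hfpos : ∀ y, 0 < f y)
    (hgpos : ∀ y, 0 < g y) (x : F) :
    gradient (fun y => Real.log (f y / (c * g y))) x
      = gradient (fun y => Real.log (f y / g y)) x := by
  simpa only [mul_comm c] using gradient_log_div_mul_const hc hfpos hgpos x

end GradientLog

/-- Jensen's inequality for the squared norm and an unnormalized weight `w`. -/
theorem norm_sq_mul_integral_le_of_weighted_mean {α F : Type*} [MeasurableSpace α] {μ : Measure α}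
    [NormedAddCommGroup F] [InnerProductSpace ℝ F] [CompleteSpace F] {w : α → ℝ} {a : α → F}
    {b : F} (hw : ∀ t, 0 ≤ w t) (hwint : Integrable w μ)
    (haint : Integrable (fun t => w t • a t) μ) (ha2 : Integrable (fun t => ‖a t‖ ^ 2 * w t) μ)
    (hmean : ∫ t, w t • a t ∂μ = (∫ t, w t ∂μ) • b) :
    ‖b‖ ^ 2 * ∫ t, w t ∂μ ≤ ∫ t, ‖a t‖ ^ 2 * w t ∂μ := by
  have hinner : ∫ t, inner ℝ b (w t • a t) ∂μ = ‖b‖ ^ 2 * ∫ t, w t ∂μ := by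
    rw [integral_inner haint, hmean, inner_smul_right, real_inner_self_eq_norm_sq, mul_comm]
  have hle : ∫ t, (2 * inner ℝ b (w t • a t) - ‖b‖ ^ 2 * w t) ∂μ
      ≤ ∫ t, ‖a t‖ ^ 2 * w t ∂μ := by
    refine integral_mono (((haint.const_inner b).const_mul 2).sub (hwint.const_mul _)) ha2
      fun t => ?_
    have h := mul_nonneg (hw t) (sq_nonneg ‖a t - b‖)
    rw [norm_sub_sq_real, real_inner_comm] at h
    simp only [inner_smul_right]
    linarith
  rw [integral_sub ((haint.const_inner b).const_mul 2) (hwint.const_mul _), integral_const_mul,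
    integral_const_mul, hinner] at hle
  linarith

theorem MeasureTheory.Integrable.smul_of_norm_sq_mul {α F : Type*} [MeasurableSpace α]
    {μ : Measure α} [NormedAddCommGroup F] [NormedSpace ℝ F] {w : α → ℝ} {a : α → F}
    (hw : ∀ t, 0 ≤ w t) (hwint : Integrable w μ) (ha : AEStronglyMeasurable a μ)
    (ha2 : Integrable (fun t => ‖a t‖ ^ 2 * w t) μ) :
    Integrable (fun t => w t • a t) μ := by
  refine (ha2.add hwint).mono' (hwint.aestronglyMeasurable.smul ha) (ae_of_all _ fun t => ?_)
  rw [norm_smul, Real.norm_of_nonneg (hw t), Pi.add_apply]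
  nlinarith [mul_nonneg (hw t) (sq_nonneg (‖a t‖ - 1)), mul_nonneg (hw t) (sq_nonneg ‖a t‖), hw t]

/-- Fisher-information decomposition inequality: the relative Fisher
information of `q` with respect to the product reference density `p ⊗ r`
dominates the sum of the marginal relative Fisher information of `q_X` w.r.t.
`p` and the conditional relative Fisher information of the conditionals
`q(u|x) = q(x,u)/q_X(x)` w.r.t. `r`. The squared norm of the full gradient on
the product space is written as the sum of the squared norms of the two
partial gradients. -/
theorem fisher_information_decomposition (dx du : ℕ)
    (p : EuclideanSpace ℝ (Fin dx) → ℝ)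
    (r : EuclideanSpace ℝ (Fin du) → ℝ)
    (q : EuclideanSpace ℝ (Fin dx) × EuclideanSpace ℝ (Fin du) → ℝ)
    (qX : EuclideanSpace ℝ (Fin dx) → ℝ)
    (hp : Differentiable ℝ p) (hppos : ∀ x, 0 < p x)
    (hr : Differentiable ℝ r) (hrpos : ∀ u, 0 < r u)
    (hq : Differentiable ℝ q) (hqpos : ∀ z, 0 < q z)
    (hqint : Integrable q) (hqone : (∫ z, q z) = 1)
    (hqX : ∀ x, qX x = ∫ u, q (x, u))
    (hqXpos : ∀ x, 0 < qX x) (hqXdiff : Differentiable ℝ qX)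
    (hexch : ∀ x, gradient qX x = ∫ u, gradient (fun x' => q (x', u)) x)
    (hI1 : Integrable (fun z =>
      (‖gradient (fun x => Real.log (q (x, z.2) / (p x * r z.2))) z.1‖ ^ 2
        + ‖gradient (fun u => Real.log (q (z.1, u) / (p z.1 * r u))) z.2‖ ^ 2) * q z))
    (hI2 : Integrable (fun x =>
      ‖gradient (fun x' => Real.log (qX x' / p x')) x‖ ^ 2 * qX x))
    (hI3 : Integrable (fun z =>
      ‖gradient (fun u => Real.log (q (z.1, u) / (qX z.1 * r u))) z.2‖ ^ 2 * q z)) :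
    (∫ x, ‖gradient (fun x' => Real.log (qX x' / p x')) x‖ ^ 2 * qX x)
      + (∫ z, ‖gradient (fun u => Real.log (q (z.1, u) / (qX z.1 * r u))) z.2‖ ^ 2 * q z)
    ≤ ∫ z, (‖gradient (fun x => Real.log (q (x, z.2) / (p x * r z.2))) z.1‖ ^ 2
        + ‖gradient (fun u => Real.log (q (z.1, u) / (p z.1 * r u))) z.2‖ ^ 2) * q z := by
  have hqx (u) : Differentiable ℝ fun x => q (x, u) :=
    hq.comp (differentiable_id.prodMk (differentiable_const u))
  have hqu (x) : Integrable fun u => q (x, u) :=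
    .of_integral_ne_zero ((hqX x) ▸ (hqXpos x).ne')
  simp only [gradient_log_div_const_mul (hqXpos _) (fun u => hqpos (_, u)) hrpos] at hI3 ⊢
  simp only [gradient_log_div_const_mul (hppos _) (fun u => hqpos (_, u)) hrpos,
    gradient_log_div_mul_const (hrpos _) (fun x => hqpos (x, _)) hppos, add_mul] at hI1 ⊢
  have hIx : Integrable fun z : EuclideanSpace ℝ (Fin dx) × EuclideanSpace ℝ (Fin du) =>
      ‖gradient (fun x => Real.log (q (x, z.2) / p x)) z.1‖ ^ 2 * q z := by
    simpa only [Pi.sub_def, add_sub_cancel_right] using hI1.sub hI3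
  rw [integral_add hIx hI3]
  gcongr ?_ + _
  rw [Measure.volume_eq_prod] at hIx
  rw [Measure.volume_eq_prod, integral_prod _ hIx]
  refine integral_mono_ae hI2 hIx.integral_prod_left ?_
  filter_upwards [hIx.prod_right_ae] with x hx
  have hgrad (u) : gradient (fun x => Real.log (q (x, u) / p x)) x
      = (q (x, u))⁻¹ • gradient (fun x => q (x, u)) x - (p x)⁻¹ • gradient p x :=
    gradient_log_div (hqx u x) (hp x) (fun _ => hqpos _) hppos
  have hsmul (u) : q (x, u) • gradient (fun x => Real.log (q (x, u) / p x)) x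
      = gradient (fun x => q (x, u)) x - q (x, u) • (p x)⁻¹ • gradient p x := by
    rw [hgrad, smul_sub, smul_inv_smul₀ (hqpos _).ne']
  have hmeas : Measurable fun u => gradient (fun x => q (x, u)) x := by
    have hcont : Continuous (Function.uncurry fun u x => q (x, u)) :=
      hq.continuous.comp continuous_swap
    exact (InnerProductSpace.toDual ℝ _).symm.continuous.measurable.comp
      ((measurable_fderiv_with_param ℝ hcont).comp measurable_prodMk_right)
  have hint : Integrable fun u => q (x, u) • gradient (fun x => Real.log (q (x, u) / p x)) x := by
    refine .smul_of_norm_sq_mul (fun u => (hqpos _).le) (hqu x) ?_ hx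
    simp only [hgrad]
    exact ((hqu x).aestronglyMeasurable.aemeasurable.inv.smul
      hmeas.aemeasurable).aestronglyMeasurable.sub aestronglyMeasurable_const
  have hconst : Integrable fun u => q (x, u) • (p x)⁻¹ • gradient p x := (hqu x).smul_const _
  have hgradint : Integrable fun u => gradient (fun x => q (x, u)) x := by
    simpa only [Pi.add_def, hsmul, sub_add_cancel] using hint.add hconst
  have hmean : ∫ u, q (x, u) • gradient (fun x => Real.log (q (x, u) / p x)) x
      = (∫ u, q (x, u)) • gradient (fun x => Real.log (qX x / p x)) x := by
    simp only [hsmul]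
    rw [integral_sub hgradint hconst, integral_smul_const, ← hexch, ← hqX,
      gradient_log_div (hqXdiff x) (hp x) hqXpos hppos, smul_sub, smul_inv_smul₀ (hqXpos x).ne']
  have hjensen := norm_sq_mul_integral_le_of_weighted_mean (fun u => (hqpos (x, u)).le) (hqu x)
    hint hx hmean
  rwa [← hqX] at hjensen
end

section
/- Fix η_θ, η_x, C_E > 0. Let ℓ : ℝ^{d_θ} × ℝ^{d_x} → ℝ be differentiable, set ρ_θ(x) := exp(ℓ(θ,x)), and let r(u) := (η_x/(2π))^{d_x/2} exp(-η_x ‖u‖²/2) be the N(0, η_x^{-1} I_{d_x}) Gaussian density. For a probability density q on ℝ^{d_x}, define E(θ,q) := ∫ q(x)(log q(x) − ℓ(θ,x)) dx and ‖∇E(θ,q)‖²_q := ‖∫ ∇_θ ℓ(θ,x) q(x) dx‖² + ∫ ‖∇_x log q(x) − ∇_x ℓ(θ,x)‖² q(x) dx. For m ∈ ℝ^{d_θ} and a probability density q on ℝ^{d_x} × ℝ^{d_x}, define F(θ,m,q) := ∫∫ q(x,u)(log q(x,u) − ℓ(θ,x) − log r(u)) dx du + (η_θ/2)‖m‖²,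 and ‖∇F(θ,m,q)‖²_q := ‖∫∫ ∇_θ ℓ(θ,x) q(x,u) dx du‖² + ‖η_θ m‖² + ∫∫ ‖∇_{(x,u)} log q(x,u) − ∇_{(x,u)} log(ρ_θ(x) r(u))‖² q(x,u) dx du. Suppose E* ∈ ℝ satisfies E(θ,q) − E* ≤ (1/(2 C_E)) ‖∇E(θ,q)‖²_q for all θ and all smooth positive probability densities q on ℝ^{d_x} for which the quantities are finite. Then, with C := min{C_E, η_θ, η_x}, for every θ ∈ ℝ^{d_θ}, m ∈ ℝ^{d_θ}, and every smooth, everywhere positive probability density q on ℝ^{d_x} × ℝ^{d_x} whose marginal q_X is positive and differentiable with ∇_x q_X(x) = ∫ ∇_x q(x,u) du and for which all the integrals above are finite, one has F(θ,m,q) − E* ≤ (1/(2C)) ‖∇F(θ,m,q)‖²_q. -/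
open MeasureTheory

/-- The Gaussian momentum reference density `r = N(0, η_x⁻¹ I)`. -/
noncomputable def momRef (dx : ℕ) (ηx : ℝ) (u : EuclideanSpace ℝ (Fin dx)) : ℝ :=
  (ηx / (2 * Real.pi)) ^ ((dx : ℝ) / 2) * Real.exp (-ηx * ‖u‖ ^ 2 / 2)

/-- The free energy `E(θ,q) = ∫ q (log q − ℓ(θ,·))`. -/
noncomputable def freeE (dθ dx : ℕ)
    (ℓ : EuclideanSpace ℝ (Fin dθ) → EuclideanSpace ℝ (Fin dx) → ℝ)
    (θ : EuclideanSpace ℝ (Fin dθ)) (q : EuclideanSpace ℝ (Fin dx) → ℝ) : ℝ :=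
  ∫ x, q x * (Real.log (q x) - ℓ θ x)

/-- The squared gradient norm `‖∇E(θ,q)‖²_q`. -/
noncomputable def gradESq (dθ dx : ℕ)
    (ℓ : EuclideanSpace ℝ (Fin dθ) → EuclideanSpace ℝ (Fin dx) → ℝ)
    (θ : EuclideanSpace ℝ (Fin dθ)) (q : EuclideanSpace ℝ (Fin dx) → ℝ) : ℝ :=
  ‖∫ x, q x • gradient (fun θ' => ℓ θ' x) θ‖ ^ 2
    + ∫ x, ‖gradient (fun x' => Real.log (q x')) x
        - gradient (fun x' => ℓ θ x') x‖ ^ 2 * q x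

/-- The momentum-enriched functional
`F(θ,m,q) = ∫∫ q (log q − ℓ(θ,x) − log r(u)) + (η_θ/2)‖m‖²`. -/
noncomputable def hamF (dθ dx : ℕ)
    (ℓ : EuclideanSpace ℝ (Fin dθ) → EuclideanSpace ℝ (Fin dx) → ℝ)
    (ηθ ηx : ℝ) (θ m : EuclideanSpace ℝ (Fin dθ))
    (q : EuclideanSpace ℝ (Fin dx) × EuclideanSpace ℝ (Fin dx) → ℝ) : ℝ :=
  (∫ z, q z * (Real.log (q z) - ℓ θ z.1 - Real.log (momRef dx ηx z.2)))
    + ηθ / 2 * ‖m‖ ^ 2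

/-- The squared gradient norm `‖∇F(θ,m,q)‖²_q`; the squared norm of the full
`(x,u)`-gradient is written as the sum of the squared norms of the two partial
gradients. -/
noncomputable def gradFSq (dθ dx : ℕ)
    (ℓ : EuclideanSpace ℝ (Fin dθ) → EuclideanSpace ℝ (Fin dx) → ℝ)
    (ηθ ηx : ℝ) (θ m : EuclideanSpace ℝ (Fin dθ))
    (q : EuclideanSpace ℝ (Fin dx) × EuclideanSpace ℝ (Fin dx) → ℝ) : ℝ :=
  ‖∫ z, q z • gradient (fun θ' => ℓ θ' z.1) θ‖ ^ 2 + ‖ηθ • m‖ ^ 2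
    + ∫ z, (‖gradient (fun x => Real.log (q (x, z.2))) z.1
          - gradient (fun x => Real.log (Real.exp (ℓ θ x) * momRef dx ηx z.2)) z.1‖ ^ 2
        + ‖gradient (fun u => Real.log (q (z.1, u))) z.2
          - gradient (fun u => Real.log (Real.exp (ℓ θ z.1) * momRef dx ηx u)) z.2‖ ^ 2)
        * q z

section

open Set Filter Topology

/-- The pointwise relative entropy integrand `a log (a / b) - a + b`. -/
noncomputable def relEnt (a b : ℝ) : ℝ := a * Real.log (a / b) - a + b

lemma relEnt_nonneg {a b : ℝ} (ha : 0 < a) (hb : 0 < b) : 0 ≤ relEnt a b := by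
  have h := Real.log_le_sub_one_of_pos (div_pos hb ha)
  have h2 : Real.log (a / b) = - Real.log (b / a) := by
    rw [← Real.log_inv, inv_div]
  have h3 : a * (b / a) = b := by field_simp
  unfold relEnt
  rw [h2]
  nlinarith [mul_le_mul_of_nonneg_left h ha.le]

lemma hasStrictDerivAt_integral_Iic {q : ℝ → ℝ} (hq : Continuous q) (hi : Integrable q) (x : ℝ) :
    HasStrictDerivAt (fun y => ∫ t in Iic y, q t) (q x) x := by
  have h : (fun y => ∫ t in Iic y, q t) = fun y =>
      (∫ t in Iic (0 : ℝ), q t) + ∫ t in (0 : ℝ)..y, q t := by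
    ext y
    rw [← intervalIntegral.integral_Iic_sub_Iic hi.integrableOn hi.integrableOn]
    ring
  rw [h]
  exact (intervalIntegral.integral_hasStrictDerivAt_right (hi.intervalIntegrable)
    (hq.stronglyMeasurableAtFilter _ _) hq.continuousAt).const_add _

lemma tendsto_integral_Iic_atTop {q : ℝ → ℝ} (hi : Integrable q) :
    Tendsto (fun y => ∫ t in Iic y, q t) atTop (𝓝 (∫ t, q t)) :=
  (aecover_Iic tendsto_id).integral_tendsto_of_countably_generated hi

lemma integral_Iic_mem_Ioo {q : ℝ → ℝ} (hpos : ∀ x, 0 < q x)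
    (hi : Integrable q) (x : ℝ) : (∫ t in Iic x, q t) ∈ Ioo 0 (∫ t, q t) := by
  constructor
  · rw [setIntegral_pos_iff_support_of_nonneg_ae (Eventually.of_forall fun x => (hpos x).le)
      hi.integrableOn]
    have : Function.support q = univ := by
      ext y; simp [(hpos y).ne']
    simp [this]
  · rw [← intervalIntegral.integral_Iic_add_Ioi hi.integrableOn hi.integrableOn (b := x)]
    have : 0 < ∫ t in Ioi x, q t := by
      rw [setIntegral_pos_iff_support_of_nonneg_ae (Eventually.of_forall fun x => (hpos x).le)
        hi.integrableOn]
      have : Function.support q = univ := by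
        ext y; simp [(hpos y).ne']
      simp [this]
    linarith

lemma strictMono_integral_Iic {q : ℝ → ℝ} (hq : Continuous q) (hpos : ∀ x, 0 < q x)
    (hi : Integrable q) : StrictMono (fun y => ∫ t in Iic y, q t) :=
  strictMono_of_deriv_pos fun x => by
    rw [(hasStrictDerivAt_integral_Iic hq hi x).hasDerivAt.deriv]; exact hpos x

/-- Monotone transport between two positive continuous densities on the line, in
differential form. -/
lemma exists_transport {q r : ℝ → ℝ} (hq : Continuous q) (hqpos : ∀ x, 0 < q x)
    (hqi : Integrable q) (hr : Continuous r) (hrpos : ∀ x, 0 < r x) (hri : Integrable r)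
    (hr1 : ∫ x, r x = 1) :
    ∃ T : ℝ → ℝ, ∀ x, HasDerivAt T (q x / ((∫ t, q t) * r (T x))) x := by
  set m := ∫ t, q t with hm
  have hmpos : 0 < m :=
    (integral_Iic_mem_Ioo hqpos hqi 0).1.trans (integral_Iic_mem_Ioo hqpos hqi 0).2
  set Φ : ℝ → ℝ := fun y => ∫ t in Iic y, r t with hΦ
  set F : ℝ → ℝ := fun y => (∫ t in Iic y, q t) / m with hF
  have hΦd : ∀ y, HasStrictDerivAt Φ (r y) y := hasStrictDerivAt_integral_Iic hr hri
  have hFd : ∀ y, HasStrictDerivAt F (q y / m) y := fun y =>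
    (hasStrictDerivAt_integral_Iic hq hqi y).div_const m
  have hΦc : Continuous Φ := continuous_iff_continuousAt.2 fun y =>
    (hΦd y).hasDerivAt.continuousAt
  have hΦinj : Function.Injective Φ := (strictMono_integral_Iic hr hrpos hri).injective
  have hex : ∀ x, ∃ y, Φ y = F x := by
    intro x
    obtain ⟨h0, h1⟩ := integral_Iic_mem_Ioo hqpos hqi x
    have h0' : 0 < F x := div_pos h0 hmpos
    have h1' : F x < 1 := (div_lt_one hmpos).2 h1
    have hb : Tendsto Φ atBot (𝓝 0) := tendsto_integral_Iic_zero tendsto_id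
    have ht : Tendsto Φ atTop (𝓝 1) := hr1 ▸ tendsto_integral_Iic_atTop hri
    obtain ⟨a, ha⟩ := (hb.eventually (gt_mem_nhds h0')).exists
    obtain ⟨b, hb⟩ := (ht.eventually (lt_mem_nhds h1')).exists
    exact mem_range_of_exists_le_of_exists_ge hΦc ⟨a, ha.le⟩ ⟨b, hb.le⟩
  choose T hT using hex
  refine ⟨T, fun x => ?_⟩
  have hne : r (T x) ≠ 0 := (hrpos _).ne'
  have hloc := (hΦd (T x)).to_localInverse hne
  have hri' := (hΦd (T x)).eventually_right_inverse hne
  rw [hT x] at hloc hri'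
  have hcomp := hloc.hasDerivAt.comp x (hFd x).hasDerivAt
  have heq : T =ᶠ[𝓝 x] HasStrictDerivAt.localInverse Φ (r (T x)) (T x) (hΦd (T x)) hne ∘ F := by
    filter_upwards [(hFd x).hasDerivAt.continuousAt.eventually hri'] with y hy
    apply hΦinj
    rw [hT y, Function.comp_apply, hy]
  have e : q x / (m * r (T x)) = (r (T x))⁻¹ * (q x / m) := by
    field_simp
  rw [e]
  exact hcomp.congr_of_eventuallyEq heq

lemma exists_gt_deriv_lt {P P' : ℝ → ℝ} {B : ℝ} (hP : ∀ x, HasDerivAt P (P' x) x)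
    (hB : ∀ x, |P x| ≤ B) {ε : ℝ} (hε : 0 < ε) (N : ℝ) : ∃ b ≥ N, P' b < ε := by
  by_contra! h
  have hB0 : 0 ≤ B := (abs_nonneg _).trans (hB 0)
  have hlt : N < N + (2 * B + 1) / ε := by
    have : 0 < (2 * B + 1) / ε := by positivity
    linarith
  obtain ⟨c, hc, hc'⟩ := exists_hasDerivAt_eq_slope P P' hlt
    (fun x _ => (hP x).continuousAt.continuousWithinAt) (fun x _ => hP x)
  have h1 := h c hc.1.le
  rw [hc', le_div_iff₀ (by linarith), add_sub_cancel_left, mul_div_cancel₀ _ hε.ne'] at h1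
  have h2 := abs_le.1 (hB N)
  have h3 := abs_le.1 (hB (N + (2 * B + 1) / ε))
  linarith

lemma exists_lt_deriv_lt {P P' : ℝ → ℝ} {B : ℝ} (hP : ∀ x, HasDerivAt P (P' x) x)
    (hB : ∀ x, |P x| ≤ B) {ε : ℝ} (hε : 0 < ε) (N : ℝ) : ∃ b ≤ N, P' b < ε := by
  have hd : ∀ x, HasDerivAt (fun x => - P (-x)) (P' (-x)) x := by
    intro x
    have := ((hP (-x)).comp x (hasDerivAt_neg x)).neg
    simp only [mul_neg, mul_one, neg_neg] at this
    exact this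
  obtain ⟨b, hb, hb'⟩ := exists_gt_deriv_lt hd (B := B) (fun x => by simpa using hB (-x)) hε (-N)
  exact ⟨-b, by linarith, hb'⟩
/-- The centred Gaussian density on the line with variance `η⁻¹`. -/
noncomputable def gaussLine (η x : ℝ) : ℝ :=
  √(η / (2 * Real.pi)) * Real.exp (-η * x ^ 2 / 2)

lemma gaussLine_pos {η : ℝ} (hη : 0 < η) (x : ℝ) : 0 < gaussLine η x := by
  unfold gaussLine
  have := Real.pi_pos
  positivity

lemma continuous_gaussLine (η : ℝ) : Continuous (gaussLine η) := by
  unfold gaussLine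
  fun_prop

lemma gaussLine_le (η : ℝ) (hη : 0 < η) (x : ℝ) : gaussLine η x ≤ √(η / (2 * Real.pi)) := by
  unfold gaussLine
  refine mul_le_of_le_one_right (Real.sqrt_nonneg _) (Real.exp_le_one_iff.2 ?_)
  nlinarith [sq_nonneg x]

lemma hasDerivAt_gaussLine (η x : ℝ) :
    HasDerivAt (gaussLine η) (-(η * x * gaussLine η x)) x := by
  have h : HasDerivAt (fun x : ℝ => -η * x ^ 2 / 2) (-η * x) x := by
    have := ((hasDerivAt_pow 2 x).const_mul (-η)).div_const 2
    exact this.congr_deriv (by push_cast; ring)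
  have := (h.exp).const_mul √(η / (2 * Real.pi))
  have e : -(η * x * gaussLine η x) =
      √(η / (2 * Real.pi)) * (Real.exp (-η * x ^ 2 / 2) * (-η * x)) := by
    unfold gaussLine; ring
  rw [e]
  exact this

lemma gaussLine_eq (η : ℝ) : gaussLine η =
    fun x => √(η / (2 * Real.pi)) * Real.exp (-(η / 2) * x ^ 2) := by
  ext x
  unfold gaussLine
  congr 2
  ring

lemma integrable_gaussLine {η : ℝ} (hη : 0 < η) : Integrable (gaussLine η) := by
  rw [gaussLine_eq]
  exact (integrable_exp_neg_mul_sq (by positivity)).const_mul _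

lemma integral_gaussLine {η : ℝ} (hη : 0 < η) : ∫ x, gaussLine η x = 1 := by
  rw [gaussLine_eq, integral_const_mul, integral_gaussian,
    ← Real.sqrt_mul (by have := Real.pi_pos; positivity)]
  have : η / (2 * Real.pi) * (Real.pi / (η / 2)) = 1 := by
    have := Real.pi_pos
    field_simp
  rw [this, Real.sqrt_one]

lemma log_gaussLine {η : ℝ} (hη : 0 < η) (x : ℝ) :
    Real.log (gaussLine η x) = Real.log √(η / (2 * Real.pi)) - η * x ^ 2 / 2 := by
  have := Real.pi_pos
  unfold gaussLine
  rw [Real.log_mul (by positivity) (by positivity), Real.log_exp]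
  ring

lemma lintegral_ofReal_eq_top {α : Type*} [MeasurableSpace α] {μ : Measure α} {f : α → ℝ}
    (hf : AEStronglyMeasurable f μ) (h0 : ∀ x, 0 ≤ f x) (hi : ¬ Integrable f μ) :
    ∫⁻ x, ENNReal.ofReal (f x) ∂μ = ⊤ := by
  by_contra h
  exact hi ⟨hf, (hasFiniteIntegral_iff_ofReal (Eventually.of_forall h0)).2 (lt_top_iff_ne_top.2 h)⟩

/-- Pointwise estimate behind the transport proof of the Gaussian logarithmic Sobolev
inequality on the line. -/
lemma mul_log_div_gaussLine_le {η m q q' x T : ℝ} (hη : 0 < η) (hm : 0 < m) (hq : 0 < q) :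
    q * Real.log (q / (m * gaussLine η x)) ≤
      q' * (T - x) + q * (q / (m * gaussLine η T) - 1)
        + 1 / (2 * η) * ((q' + η * x * q) ^ 2 / q) := by
  have hx := gaussLine_pos hη x
  have hT := gaussLine_pos hη T
  have h1 : Real.log (q / (m * gaussLine η x)) =
      Real.log (q / (m * gaussLine η T)) - η * T ^ 2 / 2 + η * x ^ 2 / 2 := by
    rw [Real.log_div hq.ne' (by positivity), Real.log_div hq.ne' (by positivity),
      Real.log_mul hm.ne' hx.ne', Real.log_mul hm.ne' hT.ne', log_gaussLine hη, log_gaussLine hη]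
    ring
  have h2 : Real.log (q / (m * gaussLine η T)) ≤ q / (m * gaussLine η T) - 1 :=
    Real.log_le_sub_one_of_pos (by positivity)
  rw [h1]
  have h3 := mul_le_mul_of_nonneg_left h2 hq.le
  have h4 : 0 ≤ (η * q * (T - x) + (q' + η * x * q)) ^ 2 / (2 * η * q) := by positivity
  have h5 : (η * q * (T - x) + (q' + η * x * q)) ^ 2 / (2 * η * q) =
      q' * (T - x) + η * x * (T - x) * q + η * q * (T - x) ^ 2 / 2
        + 1 / (2 * η) * ((q' + η * x * q) ^ 2 / q) := by
    field_simp
    ring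
  nlinarith

/-- The Gaussian logarithmic Sobolev inequality on the line. -/
lemma lintegral_relEnt_line {η : ℝ} (hη : 0 < η) {q q' : ℝ → ℝ}
    (hq : ∀ x, HasDerivAt q (q' x) x) (hq' : Continuous q') (hpos : ∀ x, 0 < q x)
    (hi : Integrable q) :
    ∫⁻ x, ENNReal.ofReal (relEnt (q x) ((∫ t, q t) * gaussLine η x)) ≤
      ∫⁻ x, ENNReal.ofReal (1 / (2 * η) * ((q' x + η * x * q x) ^ 2 / q x)) := by
  have hqc : Continuous q := continuous_iff_continuousAt.2 fun x => (hq x).continuousAt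
  obtain ⟨T, hT⟩ := exists_transport hqc hpos hi (continuous_gaussLine η) (gaussLine_pos hη)
    (integrable_gaussLine hη) (integral_gaussLine hη)
  have hm : 0 < ∫ t, q t :=
    (integral_Iic_mem_Ioo hpos hi 0).1.trans (integral_Iic_mem_Ioo hpos hi 0).2
  generalize hmdef : ∫ t, q t = m at *
  set J : ℝ → ℝ := fun x => 1 / (2 * η) * ((q' x + η * x * q x) ^ 2 / q x) with hJ
  have hJ0 : ∀ x, 0 ≤ J x := fun x => by have := hpos x; positivity
  have hJc : Continuous J := by
    refine continuous_const.mul (Continuous.div (by fun_prop) hqc fun x => (hpos x).ne')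
  by_cases hJi : Integrable J
  swap
  · rw [lintegral_ofReal_eq_top hJc.aestronglyMeasurable hJ0 hJi]
    exact le_top
  have hbd : ∀ x, HasDerivAt (fun x => -(m / η * gaussLine η (T x))) (T x * q x) x := by
    intro x
    have h := (((hasDerivAt_gaussLine η (T x)).comp x (hT x)).const_mul (m / η)).neg
    have e : T x * q x = -(m / η * (-(η * T x * gaussLine η (T x)) *
        (q x / (m * gaussLine η (T x))))) := by
      have := gaussLine_pos hη (T x)
      field_simp
    rw [e]
    exact h
  have hB : ∀ x, |(-(m / η * gaussLine η (T x)))| ≤ m / η * √(η / (2 * Real.pi)) := by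
    intro x
    have := gaussLine_pos hη (T x)
    rw [abs_neg, abs_of_pos (by positivity)]
    exact mul_le_mul_of_nonneg_left (gaussLine_le η hη _) (by positivity)
  have hb := fun n : ℕ => exists_gt_deriv_lt hbd hB (Nat.one_div_pos_of_nat (α := ℝ) (n := n)) n
  have ha := fun n : ℕ => exists_lt_deriv_lt (fun x => (hbd x).neg)
    (B := m / η * √(η / (2 * Real.pi))) (fun x => by rw [Pi.neg_apply, abs_neg]; exact hB x)
    (Nat.one_div_pos_of_nat (α := ℝ) (n := n)) (-n)
  choose b hbn hb using hb
  choose a han ha using ha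
  set H : ℝ → ℝ := fun x => relEnt (q x) (m * gaussLine η x) with hH
  have hlogc : Continuous fun x => q x * Real.log (q x / (m * gaussLine η x)) := by
    refine hqc.mul (Continuous.log (hqc.div (continuous_const.mul (continuous_gaussLine η))
      fun x => ?_) fun x => ?_)
    · have := gaussLine_pos hη x; positivity
    · have := gaussLine_pos hη x; have := hpos x; positivity
  have hgc := continuous_gaussLine η
  have hHc : Continuous H := by
    simp only [hH, relEnt]
    fun_prop
  have hH0 : ∀ x, 0 ≤ H x := fun x =>
    relEnt_nonneg (hpos x) (mul_pos hm (gaussLine_pos hη x))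
  have hta : Tendsto a atTop atBot :=
    tendsto_atBot_mono han (tendsto_neg_atTop_atBot.comp tendsto_natCast_atTop_atTop)
  have htb : Tendsto b atTop atTop := tendsto_atTop_mono hbn tendsto_natCast_atTop_atTop
  have hD : Integrable fun x => m * gaussLine η x - q x :=
    ((integrable_gaussLine hη).const_mul m).sub hi
  have hD0 : ∫ x, (m * gaussLine η x - q x) = 0 := by
    rw [integral_sub ((integrable_gaussLine hη).const_mul m) hi, integral_const_mul,
      integral_gaussLine hη, hmdef]
    ring
  have key : ∀ n, ∫ x in a n..b n, H x ≤
      2 * (1 / ((n : ℝ) + 1)) + (∫ x, J x) + ∫ x in a n..b n, (m * gaussLine η x - q x) := by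
    intro n
    have hn : (0 : ℝ) ≤ n := n.cast_nonneg
    have hab : a n ≤ b n := by linarith [han n, hbn n]
    have h1 : ∫ x in a n..b n, (q x * Real.log (q x / (m * gaussLine η x)) - J x) ≤
        q (b n) * (T (b n) - b n) - q (a n) * (T (a n) - a n) := by
      refine intervalIntegral.integral_le_sub_of_hasDeriv_right_of_le
        (g := fun x => q x * (T x - x))
        (g' := fun x => q' x * (T x - x) + q x * (q x / (m * gaussLine η (T x)) - 1)) hab
        (fun x _ => ((hq x).mul ((hT x).sub (hasDerivAt_id x))).continuousAt.continuousWithinAt)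
        (fun x _ => ((hq x).mul ((hT x).sub (hasDerivAt_id x))).hasDerivWithinAt)
        (Continuous.integrableOn_Icc (by fun_prop)) (fun x _ => ?_)
      have := mul_log_div_gaussLine_le (q' := q' x) (x := x) (T := T x) hη hm (hpos x)
      simp only [hJ]
      linarith
    have h2 : ∫ x in a n..b n, J x ≤ ∫ x, J x := by
      rw [intervalIntegral.integral_of_le hab]
      exact setIntegral_le_integral hJi (Eventually.of_forall hJ0)
    have h3 : ∫ x in a n..b n, H x =
        (∫ x in a n..b n, (q x * Real.log (q x / (m * gaussLine η x)) - J x))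
          + (∫ x in a n..b n, J x) + ∫ x in a n..b n, (m * gaussLine η x - q x) := by
      have e : H = fun x => (q x * Real.log (q x / (m * gaussLine η x)) - J x) + J x
          + (m * gaussLine η x - q x) := by
        ext x; simp only [hH, relEnt]; ring
      have i1 : IntervalIntegrable (fun x => q x * Real.log (q x / (m * gaussLine η x)) - J x)
        volume (a n) (b n) := Continuous.intervalIntegrable (by fun_prop) _ _
      have i2 : IntervalIntegrable J volume (a n) (b n) := hJc.intervalIntegrable _ _
      rw [e, intervalIntegral.integral_add (i1.add i2) hD.intervalIntegrable,
        intervalIntegral.integral_add i1 i2]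
    have h4 := hb n
    have h5 := ha n
    have h6 : 0 ≤ q (b n) * b n := mul_nonneg (hpos _).le (by linarith [hbn n])
    have h7 : 0 ≤ q (a n) * (- a n) := mul_nonneg (hpos _).le (by linarith [han n])
    nlinarith
  have hlim := (aecover_Ioc (μ := volume) hta htb).lintegral_tendsto_of_countably_generated
    (f := fun x => ENNReal.ofReal (H x)) hHc.measurable.ennreal_ofReal.aemeasurable
  have hlim2 : Tendsto (fun n : ℕ => ENNReal.ofReal (2 * (1 / ((n : ℝ) + 1)) + (∫ x, J x)
      + ∫ x in a n..b n, (m * gaussLine η x - q x))) atTop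
      (𝓝 (ENNReal.ofReal (2 * 0 + (∫ x, J x) + 0))) := by
    refine ENNReal.tendsto_ofReal (((tendsto_one_div_add_atTop_nhds_zero_nat.const_mul 2).add_const
      _).add ?_)
    rw [← hD0]
    exact intervalIntegral_tendsto_integral hD hta htb
  have hfin := le_of_tendsto_of_tendsto' hlim hlim2 fun n => by
    have hn : (0 : ℝ) ≤ n := n.cast_nonneg
    have hab : a n ≤ b n := by linarith [han n, hbn n]
    rw [← ofReal_integral_eq_lintegral_ofReal
      ((hHc.integrableOn_Icc (a := a n) (b := b n)).mono_set Ioc_subset_Icc_self)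
      (Eventually.of_forall hH0), ← intervalIntegral.integral_of_le hab]
    exact ENNReal.ofReal_le_ofReal (key n)
  rw [mul_zero, zero_add, add_zero,
    ofReal_integral_eq_lintegral_ofReal hJi (Eventually.of_forall hJ0)] at hfin
  exact hfin
lemma integral_pos_of_forall_pos {α : Type*} [MeasurableSpace α] {μ : Measure α} {f : α → ℝ}
    (hμ : μ ≠ 0) (hf : ∀ x, 0 < f x) (hi : Integrable f μ) : 0 < ∫ x, f x ∂μ := by
  rw [integral_pos_iff_support_of_nonneg (fun x => (hf x).le) hi]
  have : Function.support f = univ := by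
    ext y; simp [(hf y).ne']
  rw [this]
  exact (Measure.measure_univ_pos).2 hμ

lemma lintegral_ofReal_eq_add {α : Type*} [MeasurableSpace α] {μ : Measure α} {f g L : α → ℝ}
    (hf : 0 ≤ᵐ[μ] f) (hg : 0 ≤ᵐ[μ] g) (hgm : AEStronglyMeasurable g μ) (hL : Integrable L μ)
    (hL0 : 0 ≤ ∫ x, L x ∂μ) (h : f =ᵐ[μ] L + g) :
    ∫⁻ x, ENNReal.ofReal (f x) ∂μ =
      ENNReal.ofReal (∫ x, L x ∂μ) + ∫⁻ x, ENNReal.ofReal (g x) ∂μ := by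
  by_cases hgi : Integrable g μ
  · have hfi : Integrable f μ := (hL.add hgi).congr h.symm
    rw [← ofReal_integral_eq_lintegral_ofReal hfi hf, ← ofReal_integral_eq_lintegral_ofReal hgi hg,
      ← ENNReal.ofReal_add hL0 (integral_nonneg_of_ae hg), integral_congr_ae h]
    congr 1
    exact integral_add hL hgi
  · have hfi : ¬ Integrable f μ := fun hfi => hgi <| (hfi.sub hL).congr <| by
      filter_upwards [h] with x hx
      simp [hx]
    have hfm : AEStronglyMeasurable f μ := (hL.aestronglyMeasurable.add hgm).congr h.symm
    have h1 : ∫⁻ x, ENNReal.ofReal (f x) ∂μ = ⊤ := by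
      by_contra hc
      exact hfi ⟨hfm, (hasFiniteIntegral_iff_ofReal hf).2 (lt_top_iff_ne_top.2 hc)⟩
    have h2 : ∫⁻ x, ENNReal.ofReal (g x) ∂μ = ⊤ := by
      by_contra hc
      exact hgi ⟨hgm, (hasFiniteIntegral_iff_ofReal hg).2 (lt_top_iff_ne_top.2 hc)⟩
    rw [h1, h2, add_top]

/-- Chain rule for the relative entropy of two positive densities: the total masses split off. -/
lemma lintegral_relEnt_eq_add {α : Type*} [MeasurableSpace α] {μ : Measure α} {a b : α → ℝ}
    (ha : ∀ᵐ x ∂μ, 0 < a x) (hb : ∀ᵐ x ∂μ, 0 < b x) (hai : Integrable a μ) (hbi : Integrable b μ)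
    {A M : ℝ} (hA : ∫ x, a x ∂μ = A) (hM : ∫ x, b x ∂μ = M) (hApos : 0 < A) (hMpos : 0 < M) :
    ∫⁻ x, ENNReal.ofReal (relEnt (a x) (b x)) ∂μ =
      ENNReal.ofReal (relEnt A M) + ∫⁻ x, ENNReal.ofReal (relEnt (a x) (A / M * b x)) ∂μ := by
  have hAM : 0 < A / M := div_pos hApos hMpos
  have hLi : Integrable (fun x => a x * Real.log (A / M) + b x * (1 - A / M)) μ :=
    (hai.mul_const _).add (hbi.mul_const _)
  have hL : ∫ x, (a x * Real.log (A / M) + b x * (1 - A / M)) ∂μ = relEnt A M := by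
    rw [integral_add (hai.mul_const _) (hbi.mul_const _), integral_mul_const, integral_mul_const,
      hA, hM, relEnt]
    field_simp
    ring
  rw [← hL]
  refine lintegral_ofReal_eq_add ?_ ?_ ?_ hLi (hL ▸ relEnt_nonneg hApos hMpos) ?_
  · filter_upwards [ha, hb] with x h1 h2 using relEnt_nonneg h1 h2
  · filter_upwards [ha, hb] with x h1 h2 using relEnt_nonneg h1 (mul_pos hAM h2)
  · have h1 := hai.aemeasurable
    have h2 := hbi.aemeasurable
    unfold relEnt
    refine AEMeasurable.aestronglyMeasurable ?_
    exact ((h1.mul (Real.measurable_log.comp_aemeasurable (h1.div (h2.const_mul _)))).sub h1).add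
      (h2.const_mul _)
  · filter_upwards [ha, hb] with x h1 h2
    simp only [relEnt, Pi.add_apply]
    rw [Real.log_div h1.ne' h2.ne', Real.log_div h1.ne' (mul_pos hAM h2).ne',
      Real.log_mul hAM.ne' h2.ne']
    ring

lemma measurable_relEnt : Measurable fun p : ℝ × ℝ => relEnt p.1 p.2 := by
  unfold relEnt
  exact ((measurable_fst.mul (Real.measurable_log.comp (measurable_fst.div measurable_snd))).sub
    measurable_fst).add measurable_snd

/-- Subadditivity of the relative entropy with respect to a product reference density. -/
lemma lintegral_relEnt_prod_le {X Y : Type*} [MeasurableSpace X] [MeasurableSpace Y]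
    {μ : Measure X} {ν : Measure Y} [SFinite μ] [SFinite ν] {q : X × Y → ℝ} {a : X → ℝ} {b : Y → ℝ}
    (hqm : Measurable q) (hq : ∀ z, 0 < q z) (hqi : Integrable q (μ.prod ν))
    (ham : Measurable a) (ha : ∀ x, 0 < a x) (ha1 : ∫ x, a x ∂μ = 1)
    (hb : ∀ y, 0 < b y) (hb1 : ∫ y, b y ∂ν = 1) :
    ∫⁻ z, ENNReal.ofReal (relEnt (q z) ((∫ w, q w ∂μ.prod ν) * (a z.1 * b z.2))) ∂μ.prod ν ≤
      (∫⁻ x, ∫⁻ y, ENNReal.ofReal (relEnt (q (x, y)) ((∫ w, q (x, w) ∂ν) * b y)) ∂ν ∂μ) +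
      ∫⁻ y, ∫⁻ x, ENNReal.ofReal (relEnt (q (x, y)) ((∫ w, q (w, y) ∂μ) * a x)) ∂μ ∂ν := by
  have hμ : μ ≠ 0 := by rintro rfl; simp at ha1
  have hν : ν ≠ 0 := by rintro rfl; simp at hb1
  have hai : Integrable a μ := by
    by_contra h; simp [integral_undef h] at ha1
  have hbi : Integrable b ν := by
    by_contra h; simp [integral_undef h] at hb1
  have hμν : μ.prod ν ≠ 0 := by
    rw [← Measure.measure_univ_ne_zero, ← univ_prod_univ, Measure.prod_prod]
    exact mul_ne_zero (Measure.measure_univ_ne_zero.2 hμ) (Measure.measure_univ_ne_zero.2 hν)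
  set m := ∫ w, q w ∂μ.prod ν with hm
  have hmpos : 0 < m := integral_pos_of_forall_pos hμν hq hqi
  have hq2m : Measurable fun y => ∫ w, q (w, y) ∂μ :=
    (hqm.stronglyMeasurable.integral_prod_left' (μ := μ)).measurable
  have hq2i : Integrable (fun y => ∫ w, q (w, y) ∂μ) ν := hqi.integral_prod_right
  have hq2m' : ∫ y, ∫ w, q (w, y) ∂μ ∂ν = m := by rw [hm, integral_prod_symm _ hqi]
  have hq2pos : ∀ᵐ y ∂ν, 0 < ∫ w, q (w, y) ∂μ := by
    filter_upwards [hqi.prod_left_ae] with y hy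
    exact integral_pos_of_forall_pos hμ (fun w => hq _) hy
  rw [lintegral_lintegral_swap (μ := ν)]
  swap
  · refine Measurable.aemeasurable ?_
    refine (measurable_relEnt.comp (f := fun p : Y × X =>
      (q (p.2, p.1), (∫ w, q (w, p.1) ∂μ) * a p.2)) ?_).ennreal_ofReal
    exact (hqm.comp measurable_swap).prodMk
      ((hq2m.comp measurable_fst).mul (ham.comp measurable_snd))
  refine (lintegral_prod_le _).trans ?_
  rw [← lintegral_add_right']
  swap
  · refine (Measurable.lintegral_prod_right' (f := fun p : X × Y =>
      ENNReal.ofReal (relEnt (q p) ((∫ w, q (w, p.2) ∂μ) * a p.1))) ?_).aemeasurable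
    exact (measurable_relEnt.comp (hqm.prodMk
      ((hq2m.comp measurable_snd).mul (ham.comp measurable_fst)))).ennreal_ofReal
  refine lintegral_mono_ae ?_
  filter_upwards [hqi.prod_right_ae] with x hx
  have hA : 0 < ∫ w, q (x, w) ∂ν := integral_pos_of_forall_pos hν (fun w => hq _) hx
  have hM : 0 < m * a x := mul_pos hmpos (ha x)
  have e1 := lintegral_relEnt_eq_add (μ := ν) (a := fun y => q (x, y))
    (b := fun y => m * (a x * b y))
    (Eventually.of_forall fun y => hq _)
    (Eventually.of_forall fun y => mul_pos hmpos (mul_pos (ha x) (hb y))) hx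
    ((hbi.const_mul _).const_mul _) (A := ∫ w, q (x, w) ∂ν) (M := m * a x) rfl
    (by rw [integral_const_mul, integral_const_mul, hb1, mul_one]) hA hM
  have e2 := lintegral_relEnt_eq_add (μ := ν) (a := fun y => q (x, y))
    (b := fun y => (∫ w, q (w, y) ∂μ) * a x)
    (Eventually.of_forall fun y => hq _)
    (hq2pos.mono fun y hy => mul_pos hy (ha x)) hx
    (hq2i.mul_const _) (A := ∫ w, q (x, w) ∂ν) (M := m * a x) rfl
    (by rw [integral_mul_const, hq2m']) hA hM
  have e3 : ∀ y, (∫ w, q (x, w) ∂ν) / (m * a x) * (m * (a x * b y)) = (∫ w, q (x, w) ∂ν) * b y := by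
    intro y
    have := ha x
    field_simp
  simp only [e3] at e1
  rw [e1, add_comm, e2]
  gcongr
  exact le_self_add

lemma hasDerivAt_cons {n : ℕ} (t : ℝ) (y : Fin n → ℝ) :
    HasDerivAt (fun t => (Fin.cons t y : Fin (n + 1) → ℝ)) (Pi.single 0 1) t := by
  rw [hasDerivAt_pi]
  refine Fin.cases ?_ fun i => ?_
  · simpa using hasDerivAt_id' t
  · simpa [Pi.single_eq_of_ne (Fin.succ_ne_zero i)] using hasDerivAt_const t (y i)

lemma hasFDerivAt_cons {n : ℕ} (t : ℝ) (y : Fin n → ℝ) :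
    HasFDerivAt (fun y => (Fin.cons t y : Fin (n + 1) → ℝ))
      (ContinuousLinearMap.pi (Fin.cases 0 fun i => ContinuousLinearMap.proj i) :
        (Fin n → ℝ) →L[ℝ] (Fin (n + 1) → ℝ)) y := by
  rw [hasFDerivAt_pi]
  refine Fin.cases ?_ fun i => ?_
  · simpa using hasFDerivAt_const t y
  · simpa using hasFDerivAt_apply i y

lemma contDiff_cons {n : ℕ} :
    ContDiff ℝ 1 fun z : ℝ × (Fin n → ℝ) => (Fin.cons z.1 z.2 : Fin (n + 1) → ℝ) := by
  rw [contDiff_pi]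
  refine Fin.cases ?_ fun i => ?_
  · simpa using contDiff_fst
  · simp only [Fin.cons_succ]
    fun_prop

lemma cons_eq_piFinSuccAbove_symm (n : ℕ) :
    (fun z : ℝ × (Fin n → ℝ) => (Fin.cons z.1 z.2 : Fin (n + 1) → ℝ)) =
      (MeasurableEquiv.piFinSuccAbove (fun _ : Fin (n + 1) => ℝ) 0).symm := by
  ext z i
  simp [MeasurableEquiv.piFinSuccAbove, Fin.insertNthEquiv, Fin.insertNth_zero']

lemma measurePreserving_cons (n : ℕ) :
    MeasurePreserving (fun z : ℝ × (Fin n → ℝ) => (Fin.cons z.1 z.2 : Fin (n + 1) → ℝ)) := by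
  rw [cons_eq_piFinSuccAbove_symm]
  exact (volume_preserving_piFinSuccAbove (fun _ : Fin (n + 1) => ℝ) 0).symm

/-- The Gaussian logarithmic Sobolev inequality on `Fin n → ℝ`. -/
lemma lintegral_relEnt_pi {η : ℝ} (hη : 0 < η) (n : ℕ) {q : (Fin n → ℝ) → ℝ}
    (hq : ContDiff ℝ 1 q) (hpos : ∀ u, 0 < q u) (hi : Integrable q) :
    ∫⁻ u, ENNReal.ofReal (relEnt (q u) ((∫ w, q w) * ∏ i, gaussLine η (u i))) ≤
      ∫⁻ u, ENNReal.ofReal (1 / (2 * η) *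
        ∑ i, (fderiv ℝ q u (Pi.single i 1) + η * u i * q u) ^ 2 / q u) := by
  induction n with
  | zero =>
    have : ∀ u, relEnt (q u) ((∫ w, q w) * ∏ i, gaussLine η (u i)) = 0 := by
      intro u
      have h : ∫ w, q w = q u := by
        rw [volume_pi, Measure.pi_of_empty _ u, integral_dirac]
      rw [h]
      simp [relEnt, (hpos u).ne']
    simp only [this, ENNReal.ofReal_zero, lintegral_zero, zero_le]
  | succ n ih =>
    have hmp := measurePreserving_cons n
    set c : ℝ × (Fin n → ℝ) → (Fin (n + 1) → ℝ) := fun z => Fin.cons z.1 z.2 with hc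
    have hemb : MeasurableEmbedding c := by
      rw [hc, cons_eq_piFinSuccAbove_symm]
      exact (MeasurableEquiv.piFinSuccAbove (fun _ : Fin (n + 1) => ℝ) 0).symm.measurableEmbedding
    have hQ : ContDiff ℝ 1 (q ∘ c) := hq.comp contDiff_cons
    have hQi : Integrable (q ∘ c) := (hmp.integrable_comp_emb hemb).2 hi
    have hQm : ∫ z, q (c z) = ∫ w, q w := hmp.integral_comp hemb q
    have hdiff : Differentiable ℝ q := hq.differentiable one_ne_zero
    have hfd : Continuous (fderiv ℝ q) := hq.continuous_fderiv one_ne_zero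
    have hg1 : ∫ y : Fin n → ℝ, ∏ i, gaussLine η (y i) = 1 := by
      rw [integral_fintype_prod_volume_eq_prod (fun _ => gaussLine η)]
      simp [integral_gaussLine hη]
    rw [← hmp.lintegral_comp_emb hemb, ← hmp.lintegral_comp_emb hemb, ← hQm]
    have hsub := lintegral_relEnt_prod_le (μ := (volume : Measure ℝ))
      (ν := (volume : Measure (Fin n → ℝ))) (q := q ∘ c) (a := gaussLine η)
      (b := fun y => ∏ i, gaussLine η (y i)) hQ.continuous.measurable (fun z => hpos _) hQi
      (continuous_gaussLine η).measurable (gaussLine_pos hη) (integral_gaussLine hη)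
      (fun y => Finset.prod_pos fun i _ => gaussLine_pos hη _) hg1
    have hA0 : Continuous fun z : ℝ × (Fin n → ℝ) => ENNReal.ofReal (1 / (2 * η) *
        ((fderiv ℝ q (c z) (Pi.single 0 1) + η * z.1 * q (c z)) ^ 2 / q (c z))) := by
      have hcc : Continuous c := contDiff_cons.continuous
      have h1 : Continuous fun z => q (c z) := hQ.continuous
      have h2 : Continuous fun z => fderiv ℝ q (c z) (Pi.single 0 1) :=
        (hfd.comp hcc).clm_apply continuous_const
      exact ENNReal.continuous_ofReal.comp (continuous_const.mul
        (Continuous.div (by fun_prop) h1 fun z => (hpos _).ne'))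
    have hA1 : Continuous fun z : ℝ × (Fin n → ℝ) => ENNReal.ofReal (1 / (2 * η) *
        ∑ i, (fderiv ℝ q (c z) (Pi.single (Fin.succ i) 1) + η * z.2 i * q (c z)) ^ 2 /
          q (c z)) := by
      have hcc : Continuous c := contDiff_cons.continuous
      have h1 : Continuous fun z => q (c z) := hQ.continuous
      refine ENNReal.continuous_ofReal.comp (continuous_const.mul
        (continuous_finsetSum _ fun i _ => Continuous.div ?_ h1 fun z => (hpos _).ne'))
      have h2 : Continuous fun z => fderiv ℝ q (c z) (Pi.single (Fin.succ i) 1) :=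
        (hfd.comp hcc).clm_apply continuous_const
      fun_prop
    calc _ = ∫⁻ z : ℝ × (Fin n → ℝ), ENNReal.ofReal (relEnt ((q ∘ c) z) ((∫ w, (q ∘ c) w) *
          (gaussLine η z.1 * ∏ i, gaussLine η (z.2 i)))) := by
          refine lintegral_congr fun z => ?_
          rw [Fin.prod_univ_succ]
          rfl
      _ ≤ _ := hsub
      _ ≤ (∫⁻ t, ∫⁻ y : Fin n → ℝ, ENNReal.ofReal (1 / (2 * η) * ∑ i,
            (fderiv ℝ q (c (t, y)) (Pi.single (Fin.succ i) 1) + η * y i * q (c (t, y))) ^ 2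
              / q (c (t, y)))) +
          ∫⁻ y : Fin n → ℝ, ∫⁻ t, ENNReal.ofReal (1 / (2 * η) *
            ((fderiv ℝ q (c (t, y)) (Pi.single 0 1) + η * t * q (c (t, y))) ^ 2 /
              q (c (t, y)))) := by
          refine add_le_add (lintegral_mono_ae ?_) (lintegral_mono_ae ?_)
          · filter_upwards [hQi.prod_right_ae] with t ht
            have h := ih (q := fun y => (q ∘ c) (t, y)) (hQ.comp (contDiff_prodMk_right t))
              (fun y => hpos _) ht
            refine h.trans (le_of_eq (lintegral_congr fun y => ?_))
            have hd : HasFDerivAt (fun y => (q ∘ c) (t, y)) _ y :=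
              (hdiff (c (t, y))).hasFDerivAt.comp y (hasFDerivAt_cons t y)
            rw [hd.fderiv]
            congr 3
            ext i
            have : (ContinuousLinearMap.pi (Fin.cases 0 fun i => ContinuousLinearMap.proj i) :
                (Fin n → ℝ) →L[ℝ] (Fin (n + 1) → ℝ)) (Pi.single i 1) = Pi.single i.succ 1 := by
              ext j
              refine Fin.cases ?_ (fun j => ?_) j
              · simp
              · simp [Pi.single_apply]
            rw [ContinuousLinearMap.comp_apply, this]
            rfl
          · filter_upwards [hQi.prod_left_ae] with y hy
            exact lintegral_relEnt_line hη (q := fun t => (q ∘ c) (t, y))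
              (q' := fun t => fderiv ℝ q (c (t, y)) (Pi.single 0 1))
              (fun t => (hdiff (c (t, y))).hasFDerivAt.comp_hasDerivAt t (hasDerivAt_cons t y))
              ((hfd.comp (contDiff_cons.continuous.comp (Continuous.prodMk_left y))).clm_apply
                continuous_const) (fun t => hpos _) hy
      _ = _ := by
          rw [← lintegral_prod _ hA1.measurable.aemeasurable,
            ← lintegral_prod_symm _ hA0.measurable.aemeasurable, add_comm,
            ← lintegral_add_left hA0.measurable]
          refine lintegral_congr fun z => ?_
          have hz := hpos (c z)
          rw [← ENNReal.ofReal_add (by positivity) (by positivity), ← mul_add, Fin.sum_univ_succ]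
          rfl

section Gradient

variable {E : Type*} [NormedAddCommGroup E] [InnerProductSpace ℝ E] [CompleteSpace E]

lemma gradient_log {g : E → ℝ} {x : E} (hg : DifferentiableAt ℝ g x) (hx : g x ≠ 0) :
    gradient (fun y => Real.log (g y)) x = (g x)⁻¹ • gradient g x := by
  rw [gradient, (hg.hasFDerivAt.log hx).fderiv, map_smul, gradient]

lemma gradient_log_exp_mul_const (h : E → ℝ) {c : ℝ} (hc : 0 < c) (x : E) :
    gradient (fun y => Real.log (Real.exp (h y) * c)) x = gradient h x := by
  have : (fun y => Real.log (Real.exp (h y) * c)) = fun y => h y + Real.log c := by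
    ext y
    rw [Real.log_mul (Real.exp_pos _).ne' hc.ne', Real.log_exp]
  rw [this, gradient, fderiv_add_const, gradient]

end Gradient

lemma momRef_pos (dx : ℕ) {η : ℝ} (hη : 0 < η) (u : EuclideanSpace ℝ (Fin dx)) :
    0 < momRef dx η u := by
  have := Real.pi_pos
  unfold momRef
  positivity

lemma continuous_momRef (dx : ℕ) (η : ℝ) : Continuous (momRef dx η) := by
  unfold momRef
  fun_prop

lemma momRef_eq_prod (dx : ℕ) {η : ℝ} (hη : 0 < η) (u : EuclideanSpace ℝ (Fin dx)) :
    momRef dx η u = ∏ i, gaussLine η (u i) := by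
  have hp := Real.pi_pos
  unfold momRef gaussLine
  rw [Finset.prod_mul_distrib, Finset.prod_const, Finset.card_univ, Fintype.card_fin,
    ← Real.exp_sum, EuclideanSpace.real_norm_sq_eq, Finset.mul_sum, Finset.sum_div]
  congr 1
  rw [Real.sqrt_eq_rpow, ← Real.rpow_natCast, ← Real.rpow_mul (by positivity)]
  congr 1
  ring

lemma gradient_log_exp_mul_momRef (dx : ℕ) {η : ℝ} (hη : 0 < η) (c : ℝ)
    (u : EuclideanSpace ℝ (Fin dx)) :
    gradient (fun v => Real.log (Real.exp c * momRef dx η v)) u = -(η • u) := by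
  have hp := Real.pi_pos
  have h : (fun v => Real.log (Real.exp c * momRef dx η v)) = fun v : EuclideanSpace ℝ (Fin dx) =>
      (c + Real.log ((η / (2 * Real.pi)) ^ ((dx : ℝ) / 2))) + (-η / 2) * ‖v‖ ^ 2 := by
    ext v
    rw [Real.log_mul (Real.exp_pos _).ne' (momRef_pos dx hη v).ne', Real.log_exp, momRef,
      Real.log_mul (by positivity) (Real.exp_pos _).ne', Real.log_exp]
    ring
  rw [h]
  refine HasGradientAt.gradient ?_
  rw [hasGradientAt_iff_hasFDerivAt]
  have := ((hasStrictFDerivAt_norm_sq u).hasFDerivAt.const_mul (-η / 2)).const_add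
    (c + Real.log ((η / (2 * Real.pi)) ^ ((dx : ℝ) / 2)))
  refine this.congr_fderiv ?_
  ext v
  simp
  ring

/-- The Gaussian logarithmic Sobolev inequality for the momentum reference density. -/
lemma lintegral_relEnt_momRef (dx : ℕ) {η : ℝ} (hη : 0 < η) (c : ℝ)
    {g : EuclideanSpace ℝ (Fin dx) → ℝ}
    (hg : ContDiff ℝ 1 g) (hpos : ∀ u, 0 < g u) (hi : Integrable g) :
    ∫⁻ u, ENNReal.ofReal (relEnt (g u) ((∫ w, g w) * momRef dx η u)) ≤
      ∫⁻ u, ENNReal.ofReal (1 / (2 * η) * (‖gradient (fun v => Real.log (g v)) u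
        - gradient (fun v => Real.log (Real.exp c * momRef dx η v)) u‖ ^ 2 * g u)) := by
  have hmp := PiLp.volume_preserving_toLp (Fin dx)
  have hemb : MeasurableEmbedding (WithLp.toLp 2 : (Fin dx → ℝ) → EuclideanSpace ℝ (Fin dx)) :=
    (MeasurableEquiv.toLp 2 (Fin dx → ℝ)).measurableEmbedding
  have hdiff : Differentiable ℝ g := hg.differentiable one_ne_zero
  set L : (Fin dx → ℝ) →L[ℝ] EuclideanSpace ℝ (Fin dx) :=
    ((EuclideanSpace.equiv (Fin dx) ℝ).symm : (Fin dx → ℝ) →L[ℝ] EuclideanSpace ℝ (Fin dx)) with hL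
  have hLv : ∀ v, L v = WithLp.toLp 2 v := fun v => rfl
  have h := lintegral_relEnt_pi hη dx (q := fun v => g (WithLp.toLp 2 v))
    (hg.comp L.contDiff) (fun v => hpos _) ((hmp.integrable_comp_emb hemb).2 hi)
  rw [hmp.integral_comp hemb g] at h
  rw [← hmp.lintegral_comp_emb hemb, ← hmp.lintegral_comp_emb hemb]
  refine (le_of_eq (lintegral_congr fun v => ?_)).trans
    (h.trans (le_of_eq (lintegral_congr fun v => ?_)))
  · rw [momRef_eq_prod dx hη]
  · have hgv := hpos (WithLp.toLp 2 v)
    have hd : HasFDerivAt (fun v => g (WithLp.toLp 2 v))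
        ((fderiv ℝ g (WithLp.toLp 2 v)).comp L) v :=
      (hdiff (WithLp.toLp 2 v)).hasFDerivAt.comp v L.hasFDerivAt
    rw [gradient_log_exp_mul_momRef dx hη, gradient_log (hdiff _) hgv.ne', hd.fderiv,
      EuclideanSpace.real_norm_sq_eq, Finset.sum_mul]
    congr 3
    ext i
    have hc : gradient g (WithLp.toLp 2 v) i =
        fderiv ℝ g (WithLp.toLp 2 v) (L (Pi.single i 1)) := by
      have h1 : inner ℝ (gradient g (WithLp.toLp 2 v)) (EuclideanSpace.single i (1 : ℝ)) =
          fderiv ℝ g (WithLp.toLp 2 v) (EuclideanSpace.single i (1 : ℝ)) := by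
        rw [gradient, InnerProductSpace.toDual_symm_apply]
      rw [EuclideanSpace.inner_single_right] at h1
      simp only [one_mul, conj_trivial] at h1
      exact h1
    rw [ContinuousLinearMap.comp_apply, ← hc]
    simp only [PiLp.sub_apply, PiLp.smul_apply, PiLp.neg_apply, smul_eq_mul]
    field_simp
    ring

lemma continuous_gradient_fst {S U : Type*} [NormedAddCommGroup S] [InnerProductSpace ℝ S]
    [FiniteDimensional ℝ S] [NormedAddCommGroup U] [InnerProductSpace ℝ U]
    {q : S × U → ℝ} (hq : ContDiff ℝ 1 q) :
    Continuous fun z : S × U => gradient (fun x => q (x, z.2)) z.1 := by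
  have h : (fun z : S × U => gradient (fun x => q (x, z.2)) z.1) = fun z =>
      (InnerProductSpace.toDual ℝ S).symm
        ((fderiv ℝ q z).comp (ContinuousLinearMap.inl ℝ S U)) := by
    ext1 z
    have : HasFDerivAt (fun x => q (x, z.2)) ((fderiv ℝ q z).comp (ContinuousLinearMap.inl ℝ S U))
        z.1 :=
      (hq.differentiable one_ne_zero z).hasFDerivAt.comp z.1 (hasFDerivAt_prodMk_left z.1 z.2)
    rw [gradient, this.fderiv]
  rw [h]
  exact (LinearIsometryEquiv.continuous _).comp
    ((hq.continuous_fderiv one_ne_zero).clm_comp continuous_const)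

lemma continuous_gradient_log_fst {S U : Type*} [NormedAddCommGroup S] [InnerProductSpace ℝ S]
    [FiniteDimensional ℝ S] [NormedAddCommGroup U] [InnerProductSpace ℝ U] {q : S × U → ℝ}
    (hq : ContDiff ℝ 1 q) (hpos : ∀ z, 0 < q z) :
    Continuous fun z : S × U => gradient (fun x => Real.log (q (x, z.2))) z.1 :=
  continuous_gradient_fst (hq.log fun z => (hpos z).ne')

section WeightedMarginal

variable {S U : Type*} [NormedAddCommGroup S] [InnerProductSpace ℝ S]
  [NormedAddCommGroup U] [InnerProductSpace ℝ U] [FiniteDimensional ℝ U] [MeasurableSpace U]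
  [BorelSpace U]

lemma contDiff_integral_mul_of_hasCompactSupport {q : S × U → ℝ} (hq : ContDiff ℝ (⊤ : ℕ∞) q)
    {χ : U → ℝ} (hχ : ContDiff ℝ (⊤ : ℕ∞) χ) (hs : HasCompactSupport χ) :
    ContDiff ℝ (⊤ : ℕ∞) fun x => ∫ u, q (x, u) * χ u := by
  have h := contDiffOn_convolution_right_with_param_comp (μ := (volume : Measure U)) (n := ⊤)
    (ContinuousLinearMap.mul ℝ ℝ) (s := (univ : Set S)) (v := fun _ => (0 : U)) contDiffOn_const
    (f := fun _ : U => (1 : ℝ)) (g := fun x u => q (x, -u) * χ (-u))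
    (k := Neg.neg ⁻¹' tsupport χ) isOpen_univ
    ((Homeomorph.neg U).isCompact_preimage.2 hs)
    (fun x u _ hu => by
      have : χ (-u) = 0 := image_eq_zero_of_notMem_tsupport hu
      simp [this])
    (locallyIntegrable_const _)
    (by
      refine ContDiff.contDiffOn ?_
      change ContDiff ℝ _ fun z : S × U => q (z.1, -z.2) * χ (-z.2)
      exact (hq.comp (contDiff_fst.prodMk contDiff_snd.neg)).mul (hχ.comp contDiff_snd.neg))
  rw [contDiffOn_univ] at h
  convert h using 2 with x
  simp [convolution]

variable [FiniteDimensional ℝ S]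

lemma gradient_integral_mul_of_hasCompactSupport {q : S × U → ℝ} (hq : ContDiff ℝ 1 q)
    {χ : U → ℝ} (hχ : Continuous χ) (hs : HasCompactSupport χ) (x : S) :
    gradient (fun x => ∫ u, q (x, u) * χ u) x =
      ∫ u, χ u • gradient (fun x => q (x, u)) x := by
  have hdiff : ∀ z : S × U, HasFDerivAt (fun x => q (x, z.2))
      ((fderiv ℝ q z).comp (ContinuousLinearMap.inl ℝ S U)) z.1 := fun z =>
    (hq.differentiable one_ne_zero z).hasFDerivAt.comp z.1 (hasFDerivAt_prodMk_left z.1 z.2)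
  have hF'c : Continuous fun z : S × U =>
      χ z.2 • (fderiv ℝ q z).comp (ContinuousLinearMap.inl ℝ S U) :=
    (hχ.comp continuous_snd).smul
      ((hq.continuous_fderiv one_ne_zero).clm_comp continuous_const)
  obtain ⟨C, hC⟩ := ((isCompact_closedBall x 1).prod hs).exists_bound_of_continuousOn
    hF'c.continuousOn
  have hbound : ∀ u, ∀ y ∈ Metric.closedBall x 1,
      ‖χ u • (fderiv ℝ q (y, u)).comp (ContinuousLinearMap.inl ℝ S U)‖ ≤
        (tsupport χ).indicator (fun _ => C) u := by
    intro u y hy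
    by_cases hu : u ∈ tsupport χ
    · rw [indicator_of_mem hu]
      exact hC (y, u) ⟨hy, hu⟩
    · rw [indicator_of_notMem hu, image_eq_zero_of_notMem_tsupport hu, zero_smul, norm_zero]
  have hqc := hq.continuous
  have hd : HasFDerivAt (fun x => ∫ u, q (x, u) * χ u)
      (∫ u, χ u • (fderiv ℝ q (x, u)).comp (ContinuousLinearMap.inl ℝ S U)) x := by
    refine hasFDerivAt_integral_of_dominated_of_fderiv_le
      (F' := fun y u => χ u • (fderiv ℝ q (y, u)).comp (ContinuousLinearMap.inl ℝ S U))
      (Metric.closedBall_mem_nhds x one_pos)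
      (Eventually.of_forall fun y => Continuous.aestronglyMeasurable (by fun_prop)) ?_
      (hF'c.comp (Continuous.prodMk_right x)).aestronglyMeasurable
      (Eventually.of_forall hbound) ?_ (Eventually.of_forall fun u y _ => ?_)
    · exact Continuous.integrable_of_hasCompactSupport (by fun_prop) hs.mul_left
    · exact (integrable_indicator_iff (isClosed_tsupport χ).measurableSet).2
        (integrableOn_const hs.isCompact.measure_lt_top.ne)
    · exact (hdiff (y, u)).mul_const (χ u)
  have hi : Integrable fun u => χ u • (fderiv ℝ q (x, u)).comp (ContinuousLinearMap.inl ℝ S U) :=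
    Continuous.integrable_of_hasCompactSupport (hF'c.comp (Continuous.prodMk_right x)) hs.smul_right
  have hi2 : Integrable fun u => χ u • gradient (fun x => q (x, u)) x :=
    Continuous.integrable_of_hasCompactSupport
      (hχ.smul ((continuous_gradient_fst hq).comp (Continuous.prodMk_right x))) hs.smul_right
  refine ext_inner_left ℝ fun v => ?_
  rw [← integral_inner hi2, real_inner_comm, gradient, InnerProductSpace.toDual_symm_apply,
    hd.fderiv, ContinuousLinearMap.integral_apply hi]
  refine integral_congr_ae (Eventually.of_forall fun u => ?_)
  simp only
  rw [inner_smul_right, real_inner_comm, gradient, InnerProductSpace.toDual_symm_apply,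
    (hdiff (x, u)).fderiv]
  rfl

lemma norm_sq_mul_le_integral {α : Type*} [MeasurableSpace α] {μ : Measure α} {w : α → ℝ}
    {V : α → S} {c : S} {p : ℝ} (hw : ∀ u, 0 ≤ w u) (hwi : Integrable w μ)
    (hwV : Integrable (fun u => w u • V u) μ) (hwV2 : Integrable (fun u => ‖V u‖ ^ 2 * w u) μ)
    (hp : ∫ u, w u ∂μ = p) (hc : ∫ u, w u • V u ∂μ = p • c) :
    ‖c‖ ^ 2 * p ≤ ∫ u, ‖V u‖ ^ 2 * w u ∂μ := by
  have h1 : ∫ u, (2 * inner ℝ c (w u • V u) - ‖c‖ ^ 2 * w u) ∂μ = ‖c‖ ^ 2 * p := by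
    rw [integral_sub ((hwV.const_inner c).const_mul 2) (hwi.const_mul _), integral_const_mul,
      integral_const_mul, integral_inner hwV, hc, hp, inner_smul_right, real_inner_self_eq_norm_sq]
    ring
  rw [← h1]
  refine integral_mono (((hwV.const_inner c).const_mul 2).sub (hwi.const_mul _)) hwV2 fun u => ?_
  have h2 : 0 ≤ ‖V u - c‖ ^ 2 * w u := mul_nonneg (sq_nonneg _) (hw u)
  rw [norm_sub_sq_real, real_inner_comm] at h2
  simp only [inner_smul_right]
  linarith

lemma fisher_weighted_marginal_le {q : S × U → ℝ} (hq : ContDiff ℝ (⊤ : ℕ∞) q)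
    (hpos : ∀ z, 0 < q z) {χ : U → ℝ} (hχ : ContDiff ℝ (⊤ : ℕ∞) χ) (hs : HasCompactSupport χ)
    (hχ0 : ∀ u, 0 ≤ χ u) (x b : S) (hp : 0 < ∫ u, q (x, u) * χ u) :
    ‖gradient (fun y => Real.log (∫ u, q (y, u) * χ u)) x - b‖ ^ 2 * (∫ u, q (x, u) * χ u) ≤
      ∫ u, ‖gradient (fun y => Real.log (q (y, u))) x - b‖ ^ 2 * (q (x, u) * χ u) := by
  have hq1 : ContDiff ℝ 1 q := hq.of_le (by exact_mod_cast le_top)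
  have hqc := hq.continuous
  have hχc := hχ.continuous
  have hgl : ∀ u, gradient (fun y => Real.log (q (y, u))) x =
      (q (x, u))⁻¹ • gradient (fun y => q (y, u)) x := fun u =>
    gradient_log ((hq1.comp (contDiff_prodMk_left u)).differentiable one_ne_zero x) (hpos _).ne'
  have hgc : Continuous fun u => gradient (fun y => q (y, u)) x :=
    (continuous_gradient_fst hq1).comp (Continuous.prodMk_right x)
  have hVc : Continuous fun u => gradient (fun y => Real.log (q (y, u))) x - b := by
    simp only [hgl]
    exact ((Continuous.inv₀ (by fun_prop) fun u => (hpos _).ne').smul hgc).sub continuous_const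
  have hwc : Continuous fun u => q (x, u) * χ u := by fun_prop
  have hws : HasCompactSupport fun u => q (x, u) * χ u := hs.mul_left
  have hwi := hwc.integrable_of_hasCompactSupport (μ := volume) hws
  refine norm_sq_mul_le_integral (fun u => mul_nonneg (hpos _).le (hχ0 u)) hwi
    ((hwc.smul hVc).integrable_of_hasCompactSupport hws.smul_right)
    (((hVc.norm.pow 2).mul hwc).integrable_of_hasCompactSupport hws.mul_left) rfl ?_
  have hpd : DifferentiableAt ℝ (fun y => ∫ u, q (y, u) * χ u) x :=
    (contDiff_integral_mul_of_hasCompactSupport hq hχ hs).differentiable (by simp) x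
  have hi2 : Integrable fun u => χ u • gradient (fun y => q (y, u)) x :=
    (hχc.smul hgc).integrable_of_hasCompactSupport hs.smul_right
  have hi3 : Integrable fun u => (q (x, u) * χ u) • b := hwi.smul_const b
  rw [gradient_log hpd hp.ne', smul_sub, smul_smul, mul_inv_cancel₀ hp.ne', one_smul,
    gradient_integral_mul_of_hasCompactSupport hq1 hχc hs, ← integral_smul_const,
    ← integral_sub hi2 hi3]
  refine integral_congr_ae (Eventually.of_forall fun u => ?_)
  simp only
  rw [hgl, smul_sub, smul_smul]
  congr 2
  have := (hpos (x, u)).ne'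
  field_simp

end WeightedMarginal

section MarginalInequality

variable {S U V : Type*} [NormedAddCommGroup S] [InnerProductSpace ℝ S] [FiniteDimensional ℝ S]
  [MeasurableSpace S] [BorelSpace S]
  [NormedAddCommGroup U] [InnerProductSpace ℝ U] [FiniteDimensional ℝ U] [MeasurableSpace U]
  [BorelSpace U] [NormedAddCommGroup V] [InnerProductSpace ℝ V]

/-- The logarithmic Sobolev inequality with potential `h` and extra gradient field `k`, for smooth
positive probability densities. -/
def DensityLogSobolev (h : S → ℝ) (k : S → V) (E C : ℝ) : Prop :=
  ∀ p : S → ℝ, ContDiff ℝ (⊤ : ℕ∞) p → (∀ x, 0 < p x) → Integrable p → (∫ x, p x) = 1 →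
    Integrable (fun x => p x * (Real.log (p x) - h x)) →
    Integrable (fun x => p x • k x) →
    Integrable (fun x => ‖gradient (fun y => Real.log (p y)) x - gradient h x‖ ^ 2 * p x) →
    (∫ x, p x * (Real.log (p x) - h x)) - E ≤ C * (‖∫ x, p x • k x‖ ^ 2 +
      ∫ x, ‖gradient (fun y => Real.log (p y)) x - gradient h x‖ ^ 2 * p x)

lemma DensityLogSobolev.unnormalized {h : S → ℝ} {k : S → V} {E C : ℝ}
    (H : DensityLogSobolev h k E C) {p : S → ℝ} (hp : ContDiff ℝ (⊤ : ℕ∞) p) (hpos : ∀ x, 0 < p x)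
    (hi : Integrable p) (hent : Integrable fun x => p x * (Real.log (p x) - h x))
    (hk : Integrable fun x => p x • k x)
    (hF : Integrable fun x =>
      ‖gradient (fun y => Real.log (p y)) x - gradient h x‖ ^ 2 * p x) :
    (∫ x, p x * (Real.log (p x) - h x)) - (∫ x, p x) * Real.log (∫ x, p x) - (∫ x, p x) * E ≤
      C * ((∫ x, p x)⁻¹ * ‖∫ x, p x • k x‖ ^ 2 +
        ∫ x, ‖gradient (fun y => Real.log (p y)) x - gradient h x‖ ^ 2 * p x) := by
  have hZ : 0 < ∫ x, p x :=
    integral_pos_of_forall_pos (NeZero.ne _) hpos hi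
  set Z := ∫ x, p x with hZdef
  have hlog : ∀ x, Real.log (Z⁻¹ * p x) = Real.log (p x) - Real.log Z := fun x => by
    rw [Real.log_mul (inv_pos.2 hZ).ne' (hpos x).ne', Real.log_inv]
    ring
  have hgrad : ∀ x, gradient (fun y => Real.log (Z⁻¹ * p y)) x =
      gradient (fun y => Real.log (p y)) x := fun x => by
    simp only [hlog]
    rw [gradient, fderiv_sub_const, gradient]
  have e1 : (fun x => Z⁻¹ * p x * (Real.log (Z⁻¹ * p x) - h x)) = fun x =>
      Z⁻¹ * (p x * (Real.log (p x) - h x)) - Z⁻¹ * Real.log Z * p x := by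
    ext x
    rw [hlog]
    ring
  have e2 : (fun x => (Z⁻¹ * p x) • k x) = fun x => Z⁻¹ • (p x • k x) := by
    ext x
    rw [smul_smul]
  have e3 : (fun x => ‖gradient (fun y => Real.log (Z⁻¹ * p y)) x - gradient h x‖ ^ 2 *
      (Z⁻¹ * p x)) = fun x => Z⁻¹ *
        (‖gradient (fun y => Real.log (p y)) x - gradient h x‖ ^ 2 * p x) := by
    ext x
    rw [hgrad]
    ring
  have key := H (fun x => Z⁻¹ * p x) (contDiff_const.mul hp)
    (fun x => mul_pos (inv_pos.2 hZ) (hpos x)) (hi.const_mul _)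
    (by rw [integral_const_mul, inv_mul_cancel₀ hZ.ne'])
    (by rw [e1]; exact (hent.const_mul _).sub (hi.const_mul _))
    (by rw [e2]; exact hk.smul _) (by rw [e3]; exact hF.const_mul _)
  rw [e1, e2, e3, integral_sub (hent.const_mul _) (hi.const_mul _), integral_const_mul,
    integral_const_mul, integral_const_mul, integral_smul, norm_smul, ← hZdef, mul_pow,
    Real.norm_eq_abs, sq_abs] at key
  have := mul_le_mul_of_nonneg_left key hZ.le
  have hZ' := hZ.ne'
  field_simp at this ⊢
  linarith

lemma abs_mul_log_sub_le {p q h : ℝ} (hp : 0 < p) (hpq : p ≤ q) :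
    |p * (Real.log p - h)| ≤ |q * (Real.log q - h)| + q := by
  have hq := hp.trans_le hpq
  have e : p * (Real.log p - h) =
      p / q * (q * (Real.log q - h)) + q * (p / q * Real.log (p / q)) := by
    rw [Real.log_div hp.ne' hq.ne']
    field_simp
    ring
  have h0 : 0 < p / q := div_pos hp hq
  have h1 : p / q ≤ 1 := (div_le_one hq).2 hpq
  have h2 : |p / q * Real.log (p / q)| ≤ 1 := by
    rw [mul_comm]
    exact (Real.abs_log_mul_self_lt _ h0 h1).le
  rw [e]
  refine (abs_add_le _ _).trans (add_le_add ?_ ?_)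
  · rw [abs_mul, abs_of_pos h0]
    exact mul_le_of_le_one_left (abs_nonneg _) h1
  · rw [abs_mul, abs_of_pos hq]
    exact mul_le_of_le_one_right hq.le h2

lemma measurable_gradient (h : S → ℝ) : Measurable (gradient h) :=
  (LinearIsometryEquiv.continuous (InnerProductSpace.toDual ℝ S).symm).measurable.comp
    (measurable_fderiv ℝ h)

variable [CompleteSpace V]

lemma DensityLogSobolev.weighted_marginal {h : S → ℝ} {k : S → V} {E C : ℝ} (hC : 0 ≤ C)
    (H : DensityLogSobolev h k E C) (hh : Measurable h)
    {q : S × U → ℝ} (hq : ContDiff ℝ (⊤ : ℕ∞) q) (hpos : ∀ z, 0 < q z) (hi : Integrable q)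
    (hslice : ∀ x, Integrable fun u => q (x, u))
    (hent : Integrable fun x =>
      (∫ u, q (x, u)) * (Real.log (∫ u, q (x, u)) - h x))
    (hk : Integrable fun z : S × U => q z • k z.1)
    (hF : Integrable fun z : S × U =>
      ‖gradient (fun y => Real.log (q (y, z.2))) z.1 - gradient h z.1‖ ^ 2 * q z)
    {χ : U → ℝ} (hχ : ContDiff ℝ (⊤ : ℕ∞) χ) (hs : HasCompactSupport χ)
    (hχ0 : ∀ u, 0 ≤ χ u) (hχ1 : ∀ u, χ u ≤ 1) (hppos : ∀ x, 0 < ∫ u, q (x, u) * χ u) :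
    (∫ x, (∫ u, q (x, u) * χ u) * (Real.log (∫ u, q (x, u) * χ u) - h x))
        - (∫ x, ∫ u, q (x, u) * χ u) * Real.log (∫ x, ∫ u, q (x, u) * χ u)
        - (∫ x, ∫ u, q (x, u) * χ u) * E ≤
      C * ((∫ x, ∫ u, q (x, u) * χ u)⁻¹ * ‖∫ x, (∫ u, q (x, u) * χ u) • k x‖ ^ 2 +
        ∫ z : S × U,
          ‖gradient (fun y => Real.log (q (y, z.2))) z.1 - gradient h z.1‖ ^ 2 * q z) := by
  set p : S → ℝ := fun x => ∫ u, q (x, u) * χ u with hp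
  have hχm : AEStronglyMeasurable (fun z : S × U => χ z.2) :=
    (hχ.continuous.comp continuous_snd).aestronglyMeasurable
  have hχb : ∀ᵐ z : S × U, ‖χ z.2‖ ≤ 1 := Eventually.of_forall fun z => by
    rw [Real.norm_eq_abs, abs_of_nonneg (hχ0 _)]
    exact hχ1 _
  have hpc : ContDiff ℝ (⊤ : ℕ∞) p := contDiff_integral_mul_of_hasCompactSupport hq hχ hs
  have hqχ : Integrable (fun z : S × U => q z * χ z.2) := hi.mul_bdd (c := 1) hχm hχb
  have hpi : Integrable p := hqχ.integral_prod_left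
  have hple : ∀ x, p x ≤ ∫ u, q (x, u) := fun x =>
    integral_mono ((hslice x).mul_bdd (c := 1) hχ.continuous.aestronglyMeasurable
      (Eventually.of_forall fun u => by
        rw [Real.norm_eq_abs, abs_of_nonneg (hχ0 _)]
        exact hχ1 _)) (hslice x) fun u => mul_le_of_le_one_right (hpos _).le (hχ1 u)
  have hpk : Integrable fun x => p x • k x := by
    have : Integrable fun z : S × U => χ z.2 • (q z • k z.1) := hk.bdd_smul (C := 1) hχm hχb
    refine this.integral_prod_left.congr (Eventually.of_forall fun x => ?_)
    simp only [smul_smul, hp]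
    rw [integral_smul_const]
    simp only [mul_comm]
  have hFχ : Integrable fun z : S × U =>
      ‖gradient (fun y => Real.log (q (y, z.2))) z.1 - gradient h z.1‖ ^ 2 * (q z * χ z.2) :=
    (hF.mul_bdd (c := 1) hχm hχb).congr (Eventually.of_forall fun z => mul_assoc _ _ _)
  have hle : ∀ x, ‖gradient (fun y => Real.log (p y)) x - gradient h x‖ ^ 2 * p x ≤
      ∫ u, ‖gradient (fun y => Real.log (q (y, u))) x - gradient h x‖ ^ 2 * (q (x, u) * χ u) :=
    fun x => fisher_weighted_marginal_le hq hpos hχ hs hχ0 x _ (hppos x)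
  have hpF : Integrable fun x =>
      ‖gradient (fun y => Real.log (p y)) x - gradient h x‖ ^ 2 * p x := by
    refine hFχ.integral_prod_left.mono' (Measurable.aestronglyMeasurable ?_)
      (Eventually.of_forall fun x => ?_)
    · exact (((measurable_gradient _).sub (measurable_gradient _)).norm.pow_const 2).mul
        hpc.continuous.measurable
    · rw [Real.norm_eq_abs, abs_of_nonneg (mul_nonneg (sq_nonneg _) (hppos x).le)]
      exact hle x
  have hpent : Integrable fun x => p x * (Real.log (p x) - h x) := by
    refine (hent.abs.add hi.integral_prod_left).mono' (Measurable.aestronglyMeasurable ?_)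
      (Eventually.of_forall fun x => abs_mul_log_sub_le (hppos x) (hple x))
    exact hpc.continuous.measurable.mul
      ((Real.measurable_log.comp hpc.continuous.measurable).sub hh)
  refine (H.unnormalized hpc hppos hpi hpent hpk hpF).trans
    (mul_le_mul_of_nonneg_left (add_le_add le_rfl ?_) hC)
  calc _ ≤ ∫ x, ∫ u, ‖gradient (fun y => Real.log (q (y, u))) x - gradient h x‖ ^ 2 *
        (q (x, u) * χ u) := integral_mono hpF hFχ.integral_prod_left hle
    _ = ∫ z : S × U, ‖gradient (fun y => Real.log (q (y, z.2))) z.1 - gradient h z.1‖ ^ 2 *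
        (q z * χ z.2) := (integral_prod _ hFχ).symm
    _ ≤ _ := integral_mono hFχ hF fun z => mul_le_mul_of_nonneg_left
        (mul_le_of_le_one_right (hpos _).le (hχ1 _)) (sq_nonneg _)

/-- A logarithmic Sobolev inequality for smooth densities passes to the first marginal of a smooth
density, the Fisher information of the marginal being replaced by that of the joint density. -/
lemma DensityLogSobolev.marginal {h : S → ℝ} {k : S → V} {E C : ℝ} (hC : 0 ≤ C)
    (H : DensityLogSobolev h k E C) (hh : Measurable h)
    {q : S × U → ℝ} (hq : ContDiff ℝ (⊤ : ℕ∞) q) (hpos : ∀ z, 0 < q z) (hi : Integrable q)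
    (h1 : ∫ z, q z = 1)
    (hslice : ∀ x, Integrable fun u => q (x, u))
    (hent : Integrable fun x =>
      (∫ u, q (x, u)) * (Real.log (∫ u, q (x, u)) - h x))
    (hk : Integrable fun z : S × U => q z • k z.1)
    (hF : Integrable fun z : S × U =>
      ‖gradient (fun y => Real.log (q (y, z.2))) z.1 - gradient h z.1‖ ^ 2 * q z) :
    (∫ x, (∫ u, q (x, u)) * (Real.log (∫ u, q (x, u)) - h x)) - E ≤
      C * (‖∫ z : S × U, q z • k z.1‖ ^ 2 + ∫ z : S × U,
          ‖gradient (fun y => Real.log (q (y, z.2))) z.1 - gradient h z.1‖ ^ 2 * q z) := by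
  have hχe : ∀ n : ℕ, ∃ χ : U → ℝ, ContDiff ℝ (⊤ : ℕ∞) χ ∧ HasCompactSupport χ ∧ (∀ u, 0 ≤ χ u) ∧
      (∀ u, χ u ≤ 1) ∧ ∀ u, ‖u‖ ≤ n → χ u = 1 := fun n => by
    let f : ContDiffBump (0 : U) := ⟨n + 1, n + 2, by positivity, by linarith⟩
    refine ⟨f, f.contDiff, f.hasCompactSupport, fun u => f.nonneg, fun u => f.le_one,
      fun u hu => f.one_of_mem_closedBall ?_⟩
    rw [mem_closedBall_zero_iff]
    change ‖u‖ ≤ (n : ℝ) + 1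
    linarith
  choose χ hχ hs hχ0 hχ1 hχn using hχe
  have hlim : ∀ u, Tendsto (fun n => χ n u) atTop (𝓝 1) := fun u => by
    refine tendsto_const_nhds.congr' ?_
    filter_upwards [eventually_ge_atTop ⌈‖u‖⌉₊] with n hn
    exact (hχn n u ((Nat.le_ceil _).trans (by exact_mod_cast hn))).symm
  have hχb : ∀ n u, ‖χ n u‖ ≤ 1 := fun n u => by
    rw [Real.norm_eq_abs, abs_of_nonneg (hχ0 n u)]
    exact hχ1 n u
  have hχm : ∀ n, AEStronglyMeasurable (fun z : S × U => χ n z.2) := fun n =>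
    ((hχ n).continuous.comp continuous_snd).aestronglyMeasurable
  have hqc := hq.continuous
  have hpi : ∀ n x, Integrable fun u => q (x, u) * χ n u := fun n x =>
    (hslice x).mul_bdd (c := 1) (hχ n).continuous.aestronglyMeasurable
      (Eventually.of_forall (hχb n))
  have hppos : ∀ n x, 0 < ∫ u, q (x, u) * χ n u := fun n x => by
    rw [integral_pos_iff_support_of_nonneg (fun u => mul_nonneg (hpos _).le (hχ0 n u)) (hpi n x)]
    refine IsOpen.measure_pos _ (((hqc.comp (Continuous.prodMk_right x)).mul
      (hχ n).continuous).isOpen_support) ⟨0, ?_⟩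
    rw [Function.mem_support, hχn n 0 (by simp)]
    simpa using (hpos (x, 0)).ne'
  have hple : ∀ n x, ∫ u, q (x, u) * χ n u ≤ ∫ u, q (x, u) := fun n x =>
    integral_mono (hpi n x) (hslice x) fun u => mul_le_of_le_one_right (hpos _).le (hχ1 n u)
  have hplim : ∀ x, Tendsto (fun n => ∫ u, q (x, u) * χ n u) atTop (𝓝 (∫ u, q (x, u))) :=
    fun x => by
    refine tendsto_integral_of_dominated_convergence (fun u => q (x, u))
      (fun n => (hpi n x).aestronglyMeasurable) (hslice x)
      (fun n => Eventually.of_forall fun u => ?_)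
      (Eventually.of_forall fun u => ?_)
    · rw [norm_mul, Real.norm_eq_abs, abs_of_pos (hpos _)]
      exact mul_le_of_le_one_right (hpos _).le (hχb n u)
    · simpa using (hlim u).const_mul (q (x, u))
  have hqχ : ∀ n, Integrable fun z : S × U => q z * χ n z.2 := fun n =>
    hi.mul_bdd (c := 1) (hχm n) (Eventually.of_forall fun z => hχb n _)
  have hqX1 : ∫ x, ∫ u, q (x, u) = 1 := by rw [← h1]; exact (integral_prod _ hi).symm
  have hZ : Tendsto (fun n => ∫ x, ∫ u, q (x, u) * χ n u) atTop (𝓝 1) := by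
    rw [← hqX1]
    refine tendsto_integral_of_dominated_convergence (fun x => ∫ u, q (x, u))
      (fun n => (hqχ n).integral_prod_left.aestronglyMeasurable) hi.integral_prod_left
      (fun n => Eventually.of_forall fun x => ?_) (Eventually.of_forall hplim)
    rw [Real.norm_eq_abs, abs_of_pos (hppos n x)]
    exact hple n x
  have hent' : Tendsto (fun n => ∫ x, (∫ u, q (x, u) * χ n u) *
      (Real.log (∫ u, q (x, u) * χ n u) - h x)) atTop
      (𝓝 (∫ x, (∫ u, q (x, u)) * (Real.log (∫ u, q (x, u)) - h x))) := by
    refine tendsto_integral_of_dominated_convergence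
      (fun x => |(∫ u, q (x, u)) * (Real.log (∫ u, q (x, u)) - h x)| + ∫ u, q (x, u))
      (fun n => Measurable.aestronglyMeasurable ?_) (hent.abs.add hi.integral_prod_left)
      (fun n => Eventually.of_forall fun x => abs_mul_log_sub_le (hppos n x) (hple n x))
      (Eventually.of_forall fun x => ?_)
    · have := (contDiff_integral_mul_of_hasCompactSupport hq (hχ n) (hs n)).continuous.measurable
      exact this.mul ((Real.measurable_log.comp this).sub hh)
    · have hX : (∫ u, q (x, u)) ≠ 0 := ((hppos 0 x).trans_le (hple 0 x)).ne'
      exact (hplim x).mul (((hplim x).log hX).sub_const _)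
  have hk' : Tendsto (fun n => ∫ x, (∫ u, q (x, u) * χ n u) • k x) atTop
      (𝓝 (∫ z : S × U, q z • k z.1)) := by
    have hki : ∀ n, Integrable fun z : S × U => (q z * χ n z.2) • k z.1 := fun n =>
      (hk.bdd_smul (C := 1) (hχm n) (Eventually.of_forall fun z => hχb n z.2)).congr
        (Eventually.of_forall fun z => by simp [smul_smul, mul_comm])
    have e : ∀ n, ∫ x, (∫ u, q (x, u) * χ n u) • k x =
        ∫ z : S × U, (q z * χ n z.2) • k z.1 := fun n => by
      rw [Measure.volume_eq_prod, integral_prod _ (hki n)]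
      simp only [integral_smul_const]
    simp only [e]
    refine tendsto_integral_of_dominated_convergence (fun z => ‖q z • k z.1‖)
      (fun n => (hki n).aestronglyMeasurable) hk.norm (fun n => Eventually.of_forall fun z => ?_)
      (Eventually.of_forall fun z => ?_)
    · rw [norm_smul, norm_smul, norm_mul]
      exact mul_le_mul_of_nonneg_right (mul_le_of_le_one_right (norm_nonneg _) (hχb n _))
        (norm_nonneg _)
    · simpa using ((hlim z.2).const_mul (q z)).smul_const (k z.1)
  refine le_of_tendsto_of_tendsto' (b := atTop)
    (f := fun n => (∫ x, (∫ u, q (x, u) * χ n u) * (Real.log (∫ u, q (x, u) * χ n u) - h x))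
        - (∫ x, ∫ u, q (x, u) * χ n u) * Real.log (∫ x, ∫ u, q (x, u) * χ n u)
        - (∫ x, ∫ u, q (x, u) * χ n u) * E)
    ?_ ?_ fun n => H.weighted_marginal hC hh hq hpos hi hslice hent hk hF (hχ n) (hs n)
      (hχ0 n) (hχ1 n) (hppos n)
  · have := (hent'.sub (hZ.mul (hZ.log one_ne_zero))).sub (hZ.mul_const E)
    simpa using this
  · have := (((hZ.inv₀ one_ne_zero).mul (hk'.norm.pow 2)).add_const (∫ z : S × U,
          ‖gradient (fun y => Real.log (q (y, z.2))) z.1 - gradient h z.1‖ ^ 2 * q z)).const_mul C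
    simpa using this

end MarginalInequality

lemma integral_momRef (dx : ℕ) {η : ℝ} (hη : 0 < η) : ∫ u, momRef dx η u = 1 := by
  have hmp := PiLp.volume_preserving_toLp (Fin dx)
  have hemb : MeasurableEmbedding (WithLp.toLp 2 : (Fin dx → ℝ) → EuclideanSpace ℝ (Fin dx)) :=
    (MeasurableEquiv.toLp 2 (Fin dx → ℝ)).measurableEmbedding
  rw [← hmp.integral_comp hemb]
  simp only [momRef_eq_prod dx hη]
  rw [integral_fintype_prod_volume_eq_prod fun _ : Fin dx => gaussLine η]
  simp [integral_gaussLine hη]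

lemma integrable_momRef (dx : ℕ) {η : ℝ} (hη : 0 < η) : Integrable (momRef dx η) := by
  by_contra h
  have := integral_momRef dx hη
  rw [integral_undef h] at this
  exact zero_ne_one this

section Conditional

variable {S : Type*} [NormedAddCommGroup S] [InnerProductSpace ℝ S] [FiniteDimensional ℝ S]
  [MeasurableSpace S] [BorelSpace S]

/-- The Gaussian logarithmic Sobolev inequality applied to all slices of a joint density. -/
lemma integrable_relEnt_marginal_mul_momRef (dx : ℕ) {η : ℝ} (hη : 0 < η) (h : S → ℝ)
    {q : S × EuclideanSpace ℝ (Fin dx) → ℝ} (hq : ContDiff ℝ 1 q) (hpos : ∀ z, 0 < q z)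
    (hslice : ∀ x, Integrable fun u => q (x, u)) (hX : Measurable fun x => ∫ u, q (x, u))
    (hXpos : ∀ x, 0 < ∫ u, q (x, u))
    (hF : Integrable fun z : S × EuclideanSpace ℝ (Fin dx) =>
      ‖gradient (fun u => Real.log (q (z.1, u))) z.2
        - gradient (fun u => Real.log (Real.exp (h z.1) * momRef dx η u)) z.2‖ ^ 2 * q z) :
    Integrable (fun z : S × EuclideanSpace ℝ (Fin dx) =>
        relEnt (q z) ((∫ u, q (z.1, u)) * momRef dx η z.2)) ∧
      ∫ z : S × EuclideanSpace ℝ (Fin dx), relEnt (q z) ((∫ u, q (z.1, u)) * momRef dx η z.2) ≤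
        1 / (2 * η) * ∫ z : S × EuclideanSpace ℝ (Fin dx),
          ‖gradient (fun u => Real.log (q (z.1, u))) z.2
            - gradient (fun u => Real.log (Real.exp (h z.1) * momRef dx η u)) z.2‖ ^ 2 * q z := by
  have hm : Measurable fun z : S × EuclideanSpace ℝ (Fin dx) =>
      relEnt (q z) ((∫ u, q (z.1, u)) * momRef dx η z.2) :=
    measurable_relEnt.comp (hq.continuous.measurable.prodMk
      ((hX.comp measurable_fst).mul ((continuous_momRef dx η).measurable.comp measurable_snd)))
  have h0 : ∀ z : S × EuclideanSpace ℝ (Fin dx),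
      0 ≤ relEnt (q z) ((∫ u, q (z.1, u)) * momRef dx η z.2) := fun z =>
    relEnt_nonneg (hpos z) (mul_pos (hXpos _) (momRef_pos dx hη _))
  have hF' := hF.const_mul (1 / (2 * η))
  have hF0 : ∀ z : S × EuclideanSpace ℝ (Fin dx), 0 ≤ 1 / (2 * η) *
      (‖gradient (fun u => Real.log (q (z.1, u))) z.2
        - gradient (fun u => Real.log (Real.exp (h z.1) * momRef dx η u)) z.2‖ ^ 2 * q z) :=
    fun z => mul_nonneg (by positivity) (mul_nonneg (sq_nonneg _) (hpos z).le)
  have hle : ∫⁻ z : S × EuclideanSpace ℝ (Fin dx),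
        ENNReal.ofReal (relEnt (q z) ((∫ u, q (z.1, u)) * momRef dx η z.2)) ≤
      ∫⁻ z : S × EuclideanSpace ℝ (Fin dx), ENNReal.ofReal (1 / (2 * η) *
        (‖gradient (fun u => Real.log (q (z.1, u))) z.2
          - gradient (fun u => Real.log (Real.exp (h z.1) * momRef dx η u)) z.2‖ ^ 2 * q z)) := by
    rw [Measure.volume_eq_prod, lintegral_prod _ hm.ennreal_ofReal.aemeasurable,
      lintegral_prod _ hF'.aestronglyMeasurable.aemeasurable.ennreal_ofReal]
    exact lintegral_mono fun x => lintegral_relEnt_momRef dx hη (h x)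
      (hq.comp (contDiff_prodMk_right x)) (fun u => hpos _) (hslice x)
  have hri : Integrable fun z : S × EuclideanSpace ℝ (Fin dx) =>
      relEnt (q z) ((∫ u, q (z.1, u)) * momRef dx η z.2) := by
    refine ⟨hm.aestronglyMeasurable, ?_⟩
    rw [hasFiniteIntegral_iff_ofReal (Eventually.of_forall h0)]
    refine hle.trans_lt ?_
    rw [← hasFiniteIntegral_iff_ofReal (Eventually.of_forall hF0)]
    exact hF'.2
  refine ⟨hri, ?_⟩
  rw [← integral_const_mul,
    integral_eq_lintegral_of_nonneg_ae (Eventually.of_forall h0) hri.aestronglyMeasurable,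
    integral_eq_lintegral_of_nonneg_ae (Eventually.of_forall hF0) hF'.aestronglyMeasurable]
  refine ENNReal.toReal_mono ?_ hle
  rw [← lt_top_iff_ne_top, ← hasFiniteIntegral_iff_ofReal (Eventually.of_forall hF0)]
  exact hF'.2

/-- The free energy of a joint density splits into the relative entropy with respect to the product
of its marginal with the momentum reference density, and the free energy of the marginal. -/
lemma integral_free_energy_eq (dx : ℕ) {η : ℝ} (hη : 0 < η) (h : S → ℝ)
    {q : S × EuclideanSpace ℝ (Fin dx) → ℝ} (hpos : ∀ z, 0 < q z) (hi : Integrable q)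
    (hXpos : ∀ x, 0 < ∫ u, q (x, u))
    (hr : Integrable fun z : S × EuclideanSpace ℝ (Fin dx) =>
      relEnt (q z) ((∫ u, q (z.1, u)) * momRef dx η z.2))
    (hent : Integrable fun z : S × EuclideanSpace ℝ (Fin dx) =>
      q z * (Real.log (q z) - h z.1 - Real.log (momRef dx η z.2))) :
    Integrable (fun x => (∫ u, q (x, u)) * (Real.log (∫ u, q (x, u)) - h x)) ∧
      ∫ z : S × EuclideanSpace ℝ (Fin dx),
          q z * (Real.log (q z) - h z.1 - Real.log (momRef dx η z.2)) =
        (∫ z : S × EuclideanSpace ℝ (Fin dx),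
          relEnt (q z) ((∫ u, q (z.1, u)) * momRef dx η z.2)) +
        ∫ x, (∫ u, q (x, u)) * (Real.log (∫ u, q (x, u)) - h x) := by
  have hXi : Integrable fun x => ∫ u, q (x, u) := hi.integral_prod_left
  have hXr : Integrable fun z : S × EuclideanSpace ℝ (Fin dx) =>
      (∫ u, q (z.1, u)) * momRef dx η z.2 := hXi.mul_prod (integrable_momRef dx hη)
  have hXr1 : ∫ z : S × EuclideanSpace ℝ (Fin dx), (∫ u, q (z.1, u)) * momRef dx η z.2 =
      ∫ z, q z := by
    rw [Measure.volume_eq_prod, integral_prod_mul (fun x => ∫ u, q (x, u)) (momRef dx η),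
      integral_momRef dx hη, mul_one]
    exact (integral_prod _ hi).symm
  have hri : Integrable fun z : S × EuclideanSpace ℝ (Fin dx) =>
      relEnt (q z) ((∫ u, q (z.1, u)) * momRef dx η z.2) + q z := hr.add hi
  have hG : Integrable fun z : S × EuclideanSpace ℝ (Fin dx) =>
      relEnt (q z) ((∫ u, q (z.1, u)) * momRef dx η z.2) + q z
        - (∫ u, q (z.1, u)) * momRef dx η z.2 := hri.sub hXr
  have hGe : ∫ z : S × EuclideanSpace ℝ (Fin dx),
      (relEnt (q z) ((∫ u, q (z.1, u)) * momRef dx η z.2) + q z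
        - (∫ u, q (z.1, u)) * momRef dx η z.2) =
      ∫ z : S × EuclideanSpace ℝ (Fin dx),
        relEnt (q z) ((∫ u, q (z.1, u)) * momRef dx η z.2) := by
    rw [integral_sub hri hXr, integral_add hr hi, hXr1, add_sub_cancel_right]
  have e : ∀ z : S × EuclideanSpace ℝ (Fin dx),
      q z * (Real.log (∫ u, q (z.1, u)) - h z.1) =
        q z * (Real.log (q z) - h z.1 - Real.log (momRef dx η z.2)) -
        (relEnt (q z) ((∫ u, q (z.1, u)) * momRef dx η z.2) + q z
          - (∫ u, q (z.1, u)) * momRef dx η z.2) := fun z => by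
    rw [relEnt, Real.log_div (hpos z).ne' (mul_pos (hXpos _) (momRef_pos dx hη _)).ne',
      Real.log_mul (hXpos _).ne' (momRef_pos dx hη _).ne']
    ring
  have hW : Integrable fun z : S × EuclideanSpace ℝ (Fin dx) =>
      q z * (Real.log (∫ u, q (z.1, u)) - h z.1) := by
    simp only [e]
    exact hent.sub hG
  have hWe : ∫ z : S × EuclideanSpace ℝ (Fin dx), q z * (Real.log (∫ u, q (z.1, u)) - h z.1) =
      ∫ x, (∫ u, q (x, u)) * (Real.log (∫ u, q (x, u)) - h x) := by
    rw [Measure.volume_eq_prod, integral_prod _ hW]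
    simp only [integral_mul_const]
  refine ⟨?_, ?_⟩
  · refine hW.integral_prod_left.congr (Eventually.of_forall fun x => ?_)
    simp only [integral_mul_const]
  · rw [← hWe, ← hGe, ← integral_add hG hW]
    refine integral_congr_ae (Eventually.of_forall fun z => ?_)
    simp only [e]
    ring

end Conditional

lemma integrable_and_integrable_of_add {α : Type*} [MeasurableSpace α] {μ : Measure α}
    {f g : α → ℝ} (hf : AEStronglyMeasurable f μ) (hg : AEStronglyMeasurable g μ)
    (hf0 : ∀ x, 0 ≤ f x) (hg0 : ∀ x, 0 ≤ g x) (h : Integrable (fun x => f x + g x) μ) :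
    Integrable f μ ∧ Integrable g μ :=
  ⟨h.mono' hf (Eventually.of_forall fun x => by
      rw [Real.norm_eq_abs, abs_of_nonneg (hf0 x)]
      exact le_add_of_nonneg_right (hg0 x)),
    h.mono' hg (Eventually.of_forall fun x => by
      rw [Real.norm_eq_abs, abs_of_nonneg (hg0 x)]
      exact le_add_of_nonneg_left (hf0 x))⟩

end

/-- If the free energy `E` satisfies a log-Sobolev inequality with constant
`C_E`, then the momentum-enriched functional `F` satisfies a log-Sobolev
inequality with constant `C = min {C_E, η_θ, η_x}`. -/
theorem logSobolev_transfer (dθ dx : ℕ) (ηθ ηx CE Estar : ℝ)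
    (hηθ : 0 < ηθ) (hηx : 0 < ηx) (hCE : 0 < CE)
    (ℓ : EuclideanSpace ℝ (Fin dθ) → EuclideanSpace ℝ (Fin dx) → ℝ)
    (hℓ : Differentiable ℝ
      (fun p : EuclideanSpace ℝ (Fin dθ) × EuclideanSpace ℝ (Fin dx) => ℓ p.1 p.2))
    (hLSI : ∀ (θ : EuclideanSpace ℝ (Fin dθ)) (q : EuclideanSpace ℝ (Fin dx) → ℝ),
      ContDiff ℝ (⊤ : ℕ∞) q → (∀ x, 0 < q x) → Integrable q → (∫ x, q x) = 1 →
      Integrable (fun x => q x * (Real.log (q x) - ℓ θ x)) →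
      Integrable (fun x => q x • gradient (fun θ' => ℓ θ' x) θ) →
      Integrable (fun x => ‖gradient (fun x' => Real.log (q x')) x
          - gradient (fun x' => ℓ θ x') x‖ ^ 2 * q x) →
      freeE dθ dx ℓ θ q - Estar ≤ 1 / (2 * CE) * gradESq dθ dx ℓ θ q) :
    ∀ (θ m : EuclideanSpace ℝ (Fin dθ))
      (q : EuclideanSpace ℝ (Fin dx) × EuclideanSpace ℝ (Fin dx) → ℝ),
      ContDiff ℝ (⊤ : ℕ∞) q → (∀ z, 0 < q z) → Integrable q → (∫ z, q z) = 1 →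
      (∀ x, 0 < ∫ u, q (x, u)) →
      Differentiable ℝ (fun x => ∫ u, q (x, u)) →
      (∀ x, gradient (fun x' => ∫ u, q (x', u)) x
          = ∫ u, gradient (fun x' => q (x', u)) x) →
      Integrable (fun z => q z * (Real.log (q z) - ℓ θ z.1
          - Real.log (momRef dx ηx z.2))) →
      Integrable (fun z => q z • gradient (fun θ' => ℓ θ' z.1) θ) →
      Integrable (fun z => (‖gradient (fun x => Real.log (q (x, z.2))) z.1
            - gradient (fun x => Real.log (Real.exp (ℓ θ x) * momRef dx ηx z.2)) z.1‖ ^ 2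
          + ‖gradient (fun u => Real.log (q (z.1, u))) z.2
            - gradient (fun u => Real.log (Real.exp (ℓ θ z.1) * momRef dx ηx u)) z.2‖ ^ 2)
          * q z) →
      hamF dθ dx ℓ ηθ ηx θ m q - Estar
        ≤ 1 / (2 * min CE (min ηθ ηx)) * gradFSq dθ dx ℓ ηθ ηx θ m q := by
  intro θ m q hq hpos hi h1 hXpos hXd _ hent hk hF
  have hq1 : ContDiff ℝ 1 q := hq.of_le (by exact_mod_cast le_top)
  have hslice : ∀ x, Integrable fun u => q (x, u) := fun x => by
    by_contra h
    exact (hXpos x).ne' (integral_undef h)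
  have hh : Measurable (ℓ θ) :=
    (hℓ.continuous.comp (Continuous.prodMk_right θ)).measurable
  have hgx : ∀ z : EuclideanSpace ℝ (Fin dx) × EuclideanSpace ℝ (Fin dx),
      gradient (fun x => Real.log (Real.exp (ℓ θ x) * momRef dx ηx z.2)) z.1 =
        gradient (ℓ θ) z.1 := fun z => gradient_log_exp_mul_const _ (momRef_pos dx hηx _) _
  simp only [hgx, add_mul] at hF
  have hmx : Measurable fun z : EuclideanSpace ℝ (Fin dx) × EuclideanSpace ℝ (Fin dx) =>
      ‖gradient (fun x => Real.log (q (x, z.2))) z.1 - gradient (ℓ θ) z.1‖ ^ 2 * q z :=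
    (((continuous_gradient_log_fst hq1 hpos).measurable.sub
      ((measurable_gradient (ℓ θ)).comp measurable_fst)).norm.pow_const 2).mul
        hq.continuous.measurable
  have hmu : Measurable fun z : EuclideanSpace ℝ (Fin dx) × EuclideanSpace ℝ (Fin dx) =>
      ‖gradient (fun u => Real.log (q (z.1, u))) z.2
        - gradient (fun u => Real.log (Real.exp (ℓ θ z.1) * momRef dx ηx u)) z.2‖ ^ 2 * q z := by
    have hc : Continuous fun z : EuclideanSpace ℝ (Fin dx) × EuclideanSpace ℝ (Fin dx) =>
        gradient (fun u => Real.log (q (z.1, u))) z.2 :=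
      (continuous_gradient_log_fst (q := fun w => q w.swap)
        (hq1.comp (contDiff_snd.prodMk contDiff_fst)) fun w => hpos _).comp continuous_swap
    simp only [gradient_log_exp_mul_momRef dx hηx]
    exact (((hc.sub (continuous_snd.const_smul ηx).neg).norm.pow 2).mul hq.continuous).measurable
  obtain ⟨hFx, hFu⟩ := integrable_and_integrable_of_add hmx.aestronglyMeasurable
    hmu.aestronglyMeasurable (fun z => mul_nonneg (sq_nonneg _) (hpos z).le)
    (fun z => mul_nonneg (sq_nonneg _) (hpos z).le) hF
  obtain ⟨hr, hrle⟩ := integrable_relEnt_marginal_mul_momRef dx hηx (ℓ θ) hq1 hpos hslice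
    hXd.continuous.measurable hXpos hFu
  obtain ⟨hentX, hsplit⟩ := integral_free_energy_eq dx hηx (ℓ θ) hpos hi hXpos hr hent
  have hX := DensityLogSobolev.marginal (h := ℓ θ) (k := fun x => gradient (fun θ' => ℓ θ' x) θ)
    (one_div_nonneg.2 (by positivity : 0 ≤ 2 * CE)) (hLSI θ) hh hq hpos hi h1 hslice hentX hk hFx
  rw [hamF, gradFSq, hsplit]
  simp only [hgx, add_mul]
  rw [integral_add hFx hFu, norm_smul, mul_pow, Real.norm_eq_abs, sq_abs]
  have hFx0 : 0 ≤ ∫ z : EuclideanSpace ℝ (Fin dx) × EuclideanSpace ℝ (Fin dx),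
      ‖gradient (fun x => Real.log (q (x, z.2))) z.1 - gradient (ℓ θ) z.1‖ ^ 2 * q z :=
    integral_nonneg fun z => mul_nonneg (sq_nonneg _) (hpos z).le
  have hFu0 : 0 ≤ ∫ z : EuclideanSpace ℝ (Fin dx) × EuclideanSpace ℝ (Fin dx),
      ‖gradient (fun u => Real.log (q (z.1, u))) z.2
        - gradient (fun u => Real.log (Real.exp (ℓ θ z.1) * momRef dx ηx u)) z.2‖ ^ 2 * q z :=
    integral_nonneg fun z => mul_nonneg (sq_nonneg _) (hpos z).le
  have hC : 0 < min CE (min ηθ ηx) := lt_min hCE (lt_min hηθ hηx)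
  have hCE' := one_div_le_one_div_of_le (mul_pos two_pos hC)
    (mul_le_mul_of_nonneg_left (min_le_left CE (min ηθ ηx)) zero_le_two)
  have hηθ' := one_div_le_one_div_of_le (mul_pos two_pos hC) (mul_le_mul_of_nonneg_left
    ((min_le_right CE (min ηθ ηx)).trans (min_le_left _ _)) zero_le_two)
  have hηx' := one_div_le_one_div_of_le (mul_pos two_pos hC) (mul_le_mul_of_nonneg_left
    ((min_le_right CE (min ηθ ηx)).trans (min_le_right _ _)) zero_le_two)
  have hm : ηθ / 2 * ‖m‖ ^ 2 = 1 / (2 * ηθ) * (ηθ ^ 2 * ‖m‖ ^ 2) := by field_simp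
  have e1 := mul_le_mul_of_nonneg_right hCE' (add_nonneg (sq_nonneg
    ‖∫ z : EuclideanSpace ℝ (Fin dx) × EuclideanSpace ℝ (Fin dx),
      q z • gradient (fun θ' => ℓ θ' z.1) θ‖) hFx0)
  have e2 := mul_le_mul_of_nonneg_right hηθ' (by positivity : 0 ≤ ηθ ^ 2 * ‖m‖ ^ 2)
  have e3 := mul_le_mul_of_nonneg_right hηx' hFu0
  rw [hm]
  linarith
end

section
/- Let α, β, κ, a, c ∈ ℝ, K > 0, and let H be a real symmetric d×d matrix satisfying −K I_d ⪯ H ⪯ K I_d. Let A be the symmetric 2d×2d block matrix A = [[α I_d, β I_d + a H],[β I_d + a H, κ I_d + c H]]. Suppose the following conditions hold: |c| K − α − κ ≤ 0 (i.e. −cK − α − κ ≤ 0 if c ≤ 0 and cK − α − κ ≤ 0 if c > 0); a² K² − (c α − 2 β a) K − α κ + β² ≤ 0; and a² K² + (c α − 2 β a) K − α κ + β² ≤ 0. Then A is positive semi-definite. -/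
open scoped Matrix in
/-- The Kronecker product of a positive semidefinite `2 × 2` matrix `[[p, q], [q, r]]` with a
positive semidefinite matrix `P`, written in block form, is positive semidefinite. -/
theorem Matrix.PosSemidef.fromBlocks_smul {n : Type*} [Fintype n] {P : Matrix n n ℝ}
    (hP : P.PosSemidef) {p q r : ℝ} (hp : 0 ≤ p) (hr : 0 ≤ r) (hq : q ^ 2 ≤ p * r) :
    (Matrix.fromBlocks (p • P) (q • P) (q • P) (r • P)).PosSemidef := by
  have hPt : Pᵀ = P := by simpa [Matrix.IsHermitian] using hP.isHermitian
  refine .of_dotProduct_mulVec_nonneg ?_ fun v => ?_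
  · simp [Matrix.IsHermitian, Matrix.fromBlocks_transpose, hPt]
  obtain ⟨x, y, rfl⟩ : ∃ x y : n → ℝ, v = Sum.elim x y :=
    ⟨v ∘ Sum.inl, v ∘ Sum.inr, (Sum.elim_comp_inl_inr v).symm⟩
  have hsymm : y ⬝ᵥ P *ᵥ x = x ⬝ᵥ P *ᵥ y := by
    rw [Matrix.dotProduct_mulVec, ← Matrix.mulVec_transpose, hPt, dotProduct_comm]
  have hy : 0 ≤ y ⬝ᵥ P *ᵥ y := by simpa using hP.dotProduct_mulVec_nonneg y
  have hxy : 0 ≤ p ^ 2 * (x ⬝ᵥ P *ᵥ x) + 2 * p * q * (x ⬝ᵥ P *ᵥ y) + q ^ 2 * (y ⬝ᵥ P *ᵥ y) := by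
    have h := hP.dotProduct_mulVec_nonneg (p • x + q • y)
    simp only [star_trivial, Matrix.mulVec_add, Matrix.mulVec_smul, add_dotProduct,
      dotProduct_add, smul_dotProduct, dotProduct_smul, smul_eq_mul, hsymm] at h
    linarith
  suffices 0 ≤ p * (x ⬝ᵥ P *ᵥ x) + 2 * q * (x ⬝ᵥ P *ᵥ y) + r * (y ⬝ᵥ P *ᵥ y) by
    simp only [star_trivial, Matrix.fromBlocks_mulVec, Sum.elim_comp_inl, Sum.elim_comp_inr,
      sumElim_dotProduct_sumElim, Matrix.smul_mulVec, dotProduct_add, dotProduct_smul,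
      smul_eq_mul, hsymm]
    linarith
  rcases hp.eq_or_lt with rfl | hp
  · obtain rfl : q = 0 := by nlinarith
    simpa using mul_nonneg hr hy
  · refine nonneg_of_mul_nonneg_right ?_ hp
    linarith [mul_nonneg (sub_nonneg.2 hq) hy]

/-- A real symmetric `2 × 2` matrix with nonnegative trace and determinant has nonnegative
diagonal. -/
theorem nonneg_and_nonneg_of_add_nonneg_of_sq_le_mul {p q r : ℝ} (h : 0 ≤ p + r)
    (hq : q ^ 2 ≤ p * r) : 0 ≤ p ∧ 0 ≤ r := by
  have := (sq_nonneg q).trans hq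
  constructor <;> by_contra! <;> nlinarith

/-- Sufficient conditions for positive semi-definiteness of the symmetric block
matrix `A = [[α I, β I + a H], [β I + a H, κ I + c H]]` where `H` is symmetric
with `−K I ⪯ H ⪯ K I`. -/
theorem blockMatrix_posSemidef (d : ℕ) (α β κ a c K : ℝ) (hK : 0 < K)
    (H : Matrix (Fin d) (Fin d) ℝ) (hH : H.IsSymm)
    (hHupper : (K • (1 : Matrix (Fin d) (Fin d) ℝ) - H).PosSemidef)
    (hHlower : (H + K • (1 : Matrix (Fin d) (Fin d) ℝ)).PosSemidef)
    (h1 : |c| * K - α - κ ≤ 0)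
    (h2 : a ^ 2 * K ^ 2 - (c * α - 2 * β * a) * K - α * κ + β ^ 2 ≤ 0)
    (h3 : a ^ 2 * K ^ 2 + (c * α - 2 * β * a) * K - α * κ + β ^ 2 ≤ 0) :
    (Matrix.fromBlocks
        (α • (1 : Matrix (Fin d) (Fin d) ℝ)) (β • 1 + a • H)
        (β • 1 + a • H) (κ • 1 + c • H)).PosSemidef := by
  have hc := abs_le.1 (show |c * K| ≤ α + κ by rw [abs_mul, abs_of_pos hK]; linarith)
  have hq₁ : (β + a * K) ^ 2 ≤ α * (κ + c * K) := by linarith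
  have hq₂ : (β - a * K) ^ 2 ≤ α * (κ - c * K) := by linarith
  obtain ⟨hα, hr₁⟩ := nonneg_and_nonneg_of_add_nonneg_of_sq_le_mul (by linarith) hq₁
  obtain ⟨-, hr₂⟩ := nonneg_and_nonneg_of_add_nonneg_of_sq_le_mul (by linarith) hq₂
  -- The block matrix is affine in `H`, hence a combination of its values at `H = K` and `H = -K`.
  convert ((hHlower.fromBlocks_smul hα hr₁ hq₁).add
    (hHupper.fromBlocks_smul hα hr₂ hq₂)).smul (show 0 ≤ (2 * K)⁻¹ by positivity) using 1
  rw [Matrix.fromBlocks_add, Matrix.fromBlocks_smul]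
  congr 1 <;>
  · ext i j
    simp only [Matrix.add_apply, Matrix.sub_apply, Matrix.smul_apply, smul_eq_mul]
    field_simp
    ring
end
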